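/- arXiv:math/0201052 — 2 statements merged into one kernel-verified Lean document; each statement's English description precedes it below -/
import Mathlib

section
/- Let Λ be a ring, C an object of D(Mod Λ) isomorphic to a bounded-above complex of finitely generated projectives, and X_0 → X_1 → X_2 → ⋯ a sequence in D(Mod Λ) such that the family {X_i} is uniformly bounded below. Then Hom(C, hocolim(X_i)) ≅ colim Hom(C, X_i). -/
open CategoryTheory CategoryTheory.Limits CategoryTheory.Pretriangulated
  DerivedCategory

/-- The composite transition map `Y i ⟶ Y (i + j)` of a sequence of maps
`α i : Y i ⟶ Y (i+1)`. -/
def transMap {T : Type*} [Category T] (Y : ℕ → T) (α : ∀ i, Y i ⟶ Y (i + 1))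
    (i : ℕ) : ∀ j, Y i ⟶ Y (i + j)
  | 0 => 𝟙 (Y i)
  | j + 1 => transMap Y α i j ≫ α (i + j)

lemma aux_hom_ext (Λ : Type) [Ring Λ] (Xc : ℕ → CochainComplex (ModuleCat.{0} Λ) ℤ) (k : ℤ)
    {Z : ModuleCat.{0} Λ} (a b : (∐ Xc).X k ⟶ Z)
    (h : ∀ i, (Sigma.ι Xc i).f k ≫ a = (Sigma.ι Xc i).f k ≫ b) : a = b :=
  Cofan.IsColimit.hom_ext (isColimitCofanMkObjOfIsColimit
    (HomologicalComplex.eval (ModuleCat.{0} Λ) (ComplexShape.up ℤ) k) _ _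
    (coproductIsCoproduct Xc)) _ _ h

noncomputable def partSum {Λ : Type} [Ring Λ] (Xc : ℕ → CochainComplex (ModuleCat.{0} Λ) ℤ) (M : ℕ) :
    (∐ Xc) ⟶ ∐ Xc := ∑ i ∈ Finset.range M, Sigma.π Xc i ≫ Sigma.ι Xc i

lemma ι_partSum {Λ : Type} [Ring Λ] (Xc : ℕ → CochainComplex (ModuleCat.{0} Λ) ℤ) (M i : ℕ)
    (h : i < M) : Sigma.ι Xc i ≫ partSum Xc M = Sigma.ι Xc i := by
  rw [partSum, Preadditive.comp_sum, Finset.sum_eq_single i]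
  · rw [← Category.assoc, Sigma.ι_π_eq_id, Category.id_comp]
  · intro b _ hb
    rw [← Category.assoc, Sigma.ι_π_of_ne _ hb.symm, zero_comp]
  · intro h'
    exact absurd (Finset.mem_range.2 h) h'

lemma aux_support {Λ : Type} [Ring Λ] (Xc : ℕ → CochainComplex (ModuleCat.{0} Λ) ℤ) (k : ℤ)
    (x : (∐ Xc).X k) : ∃ N, ∀ M ≥ N, (partSum Xc M).f k x = x := by
  let S : Submodule Λ ((∐ Xc).X k) := ⨆ i, LinearMap.range ((Sigma.ι Xc i).f k).hom
  have hS : ModuleCat.ofHom S.mkQ = 0 := by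
    apply aux_hom_ext
    intro i
    ext y
    simp only [comp_zero]
    change S.mkQ (((Sigma.ι Xc i).f k).hom y) = 0
    rw [Submodule.mkQ_apply, Submodule.Quotient.mk_eq_zero]
    exact Submodule.mem_iSup_of_mem i ⟨y, rfl⟩
  have hx : x ∈ S := by
    rw [← Submodule.Quotient.mk_eq_zero]
    exact congrArg (fun f => f.hom x) hS
  refine Submodule.iSup_induction _ (motive := fun x => ∃ N, ∀ M ≥ N, (partSum Xc M).f k x = x)
    hx ?_ ⟨0, fun _ _ => map_zero ((partSum Xc _).f k).hom⟩ ?_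
  · rintro i _ ⟨y, rfl⟩
    refine ⟨i + 1, fun M hM => ?_⟩
    have := congrArg (fun f => (f.f k).hom y) (ι_partSum Xc M i (by omega))
    simpa using this
  · rintro x y ⟨N, hN⟩ ⟨N', hN'⟩
    refine ⟨max N N', fun M hM => ?_⟩
    have := hN M (le_trans (le_max_left _ _) hM)
    have := hN' M (le_trans (le_max_right _ _) hM)
    rw [map_add]
    congr 1

lemma aux_exact {Λ : Type} [Ring Λ] (Xc : ℕ → CochainComplex (ModuleCat.{0} Λ) ℤ) (j : ℤ)
    (h : ∀ i, (Xc i).ExactAt j) : (∐ Xc).ExactAt j := by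
  have h' : ∀ i, ∀ x : (Xc i).X j, (Xc i).d j (j+1) x = 0 → ∃ y, (Xc i).d (j-1) j y = x := by
    intro i
    have := h i
    rw [HomologicalComplex.exactAt_iff' _ (j-1) j (j+1) (by simp) (by simp),
      ShortComplex.moduleCat_exact_iff] at this
    exact this
  rw [HomologicalComplex.exactAt_iff' _ (j-1) j (j+1) (by simp) (by simp),
      ShortComplex.moduleCat_exact_iff]
  intro x hx
  change (∐ Xc).X j at x
  change (∐ Xc).d j (j+1) x = 0 at hx
  change ∃ y, (∐ Xc).d (j-1) j y = x
  obtain ⟨N, hN⟩ := aux_support Xc j x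
  have hN := hN N le_rfl
  have h2 : ∀ i, ∃ y, (Xc i).d (j-1) j y = (Sigma.π Xc i).f j x := by
    intro i
    apply h'
    have := congrArg (fun f => f.hom x) ((Sigma.π Xc i).comm j (j+1))
    simp only [ModuleCat.hom_comp, LinearMap.comp_apply] at this
    refine this.trans ?_
    erw [hx]
    exact map_zero ((Sigma.π Xc i).f (j+1)).hom
  choose y hy using h2
  refine ⟨∑ i ∈ Finset.range N, (Sigma.ι Xc i).f (j-1) (y i), ?_⟩
  have hs : (partSum Xc N).f j = ∑ i ∈ Finset.range N, (Sigma.π Xc i ≫ Sigma.ι Xc i).f j :=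
    (HomologicalComplex.eval (ModuleCat.{0} Λ) (ComplexShape.up ℤ) j).map_sum _ _
  rw [map_sum, ← hN, hs]
  have hs2 : (∑ i ∈ Finset.range N, (Sigma.π Xc i ≫ Sigma.ι Xc i).f j).hom x =
      ∑ i ∈ Finset.range N, ((Sigma.π Xc i ≫ Sigma.ι Xc i).f j).hom x := by
    rw [ModuleCat.hom_sum, LinearMap.sum_apply]
  refine Eq.trans ?_ hs2.symm
  refine Finset.sum_congr rfl fun i _ => ?_
  have := congrArg (fun f => f.hom (y i)) ((Sigma.ι Xc i).comm (j-1) j)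
  simp only [ModuleCat.hom_comp, LinearMap.comp_apply] at this
  refine this.trans ?_
  erw [hy i]
  rfl

lemma aux_lift {Λ : Type} [Ring Λ] [HasDerivedCategory (ModuleCat.{0} Λ)]
    (K L : CochainComplex (ModuleCat.{0} Λ) ℤ) [K.IsKProjective] (v : Q.obj K ⟶ Q.obj L) :
    ∃ f : K ⟶ L, Q.map f = v := by
  obtain ⟨g, hg⟩ := (CochainComplex.IsKProjective.Qh_map_bijective K
    ((HomotopyCategory.quotient _ _).obj L)).surjective
    ((quotientCompQhIso _).hom.app K ≫ v ≫ (quotientCompQhIso _).inv.app L)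
  obtain ⟨f, rfl⟩ := (HomotopyCategory.quotient _ _).map_surjective g
  refine ⟨f, ?_⟩
  have h := (quotientCompQhIso (ModuleCat.{0} Λ)).hom.naturality f
  rw [← cancel_epi ((quotientCompQhIso _).hom.app K), ← h, Functor.comp_map, hg]
  simp

lemma aux_zero {Λ : Type} [Ring Λ] [HasDerivedCategory (ModuleCat.{0} Λ)]
    (K L : CochainComplex (ModuleCat.{0} Λ) ℤ) (f : K ⟶ L) (m : ℤ) [L.IsGE m]
    (hf : ∀ k ≥ m, f.f k = 0) : Q.map f = 0 := by
  have : f ≫ L.πTruncGE m = 0 := by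
    ext1 k
    by_cases hk : m ≤ k
    · simp [hf k hk]
    · exact (CochainComplex.isZero_of_isStrictlyGE (L.truncGE m) m k (by omega)).eq_of_tgt _ _
  rw [← cancel_mono (Q.map (L.πTruncGE m)), ← Functor.map_comp, this]
  simp

lemma aux_main {Λ : Type} [Ring Λ] [HasDerivedCategory (ModuleCat.{0} Λ)]
    (K L : CochainComplex (ModuleCat.{0} Λ) ℤ)
    (hfg : ∀ n : ℤ, Module.Finite Λ (K.X n))
    (hproj : ∀ n : ℤ, Module.Projective Λ (K.X n))
    (hbdd : ∃ b : ℤ, ∀ n ≥ b, IsZero (K.X n)) (m : ℤ) [L.IsGE m]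
    (E : ℕ → (L ⟶ L)) (hE : ∀ (k : ℤ) (x : L.X k), ∃ N, ∀ M ≥ N, (E M).f k x = x)
    (v : Q.obj K ⟶ Q.obj L) : ∃ N, v ≫ Q.map (E N) = v := by
  obtain ⟨b, hb⟩ := hbdd
  have : K.IsStrictlyLE b := by
    rw [CochainComplex.isStrictlyLE_iff]
    exact fun i hi => hb i hi.le
  have : ∀ n, Projective (K.X n) := fun n => by
    have := hproj n
    exact ModuleCat.projective_of_categoryTheory_projective _
  have : K.IsKProjective := CochainComplex.isKProjective_of_projective K b
  obtain ⟨f, rfl⟩ := aux_lift K L v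
  have h1 : ∀ k, ∃ N, ∀ M ≥ N, (f ≫ E M - f).f k = 0 := by
    intro k
    obtain ⟨s, hs⟩ := (hfg k).fg_top
    choose N hN using fun x => hE k ((f.f k).hom x)
    refine ⟨s.sup N, fun M hM => ?_⟩
    rw [HomologicalComplex.sub_f_apply, sub_eq_zero]
    ext1
    refine LinearMap.ext_on hs fun x hx => ?_
    exact hN x M ((Finset.le_sup hx).trans hM)
  choose N hN using h1
  refine ⟨(Finset.Icc m b).sup N, ?_⟩
  rw [← Functor.map_comp, ← sub_eq_zero, ← Functor.map_sub]
  refine aux_zero _ _ _ m fun k hk => ?_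
  by_cases hkb : k ≤ b
  · exact hN k _ (Finset.le_sup (Finset.mem_Icc.2 ⟨hk, hkb⟩))
  · exact (hb k (by omega)).eq_of_src _ _

/-- Let `Λ` be a ring, `C` an object of `D(Mod Λ)` isomorphic to
a bounded-above complex of finitely generated projectives, and
`X₀ → X₁ → X₂ → ⋯` a sequence in `D(Mod Λ)` whose objects are uniformly
bounded below.  Then `Hom(C, hocolim Xᵢ) ≅ colim Hom(C, Xᵢ)`.  Here the
homotopy colimit `H` is given by a distinguished triangle
`⊕Xᵢ → ⊕Xᵢ → H → (⊕Xᵢ)[1]`, the first map restricting on `Xᵢ` to `id - αᵢ`,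
and the identification with the colimit says that the comparison maps
`Hom(C, Xᵢ) → Hom(C, H)` are compatible, jointly surjective, and kill exactly
the elements that die under some composite transition map. -/
theorem stmt_12 (Λ : Type) [Ring Λ] [HasDerivedCategory (ModuleCat.{0} Λ)]
    (Cc : CochainComplex (ModuleCat.{0} Λ) ℤ)
    (hfg : ∀ n : ℤ, Module.Finite Λ (Cc.X n))
    (hproj : ∀ n : ℤ, Module.Projective Λ (Cc.X n))
    (hbdd : ∃ b : ℤ, ∀ n ≥ b, IsZero (Cc.X n))
    (C : DerivedCategory (ModuleCat.{0} Λ)) (eC : C ≅ Q.obj Cc)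
    (Xc : ℕ → CochainComplex (ModuleCat.{0} Λ) ℤ)
    (hunif : ∃ n : ℤ, ∀ (i : ℕ) (j : ℤ), j < n → IsZero ((Xc i).homology j))
    (α : ∀ i, Q.obj (Xc i) ⟶ Q.obj (Xc (i + 1)))
    -- `Q.obj (∐ Xc)`, with the images of the canonical injections, is the
    -- coproduct of the `Q.obj (Xc i)` in the derived category
    (hc : IsColimit (Cofan.mk (Q.obj (∐ Xc))
      (fun i : ℕ => Q.map (Sigma.ι Xc i))))
    (H : DerivedCategory (ModuleCat.{0} Λ))
    (g : Q.obj (∐ Xc) ⟶ H) (δ : H ⟶ (Q.obj (∐ Xc))⟦(1 : ℤ)⟧)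
    (htri : Triangle.mk
        (hc.desc (Cofan.mk (Q.obj (∐ Xc)) (fun i : ℕ =>
          Q.map (Sigma.ι Xc i) - (α i ≫ Q.map (Sigma.ι Xc (i + 1)))))) g δ
      ∈ distTriang (DerivedCategory (ModuleCat.{0} Λ))) :
    (∀ (i : ℕ) (u : C ⟶ Q.obj (Xc i)),
        (u ≫ α i) ≫ (Q.map (Sigma.ι Xc (i + 1)) ≫ g)
          = u ≫ (Q.map (Sigma.ι Xc i) ≫ g)) ∧
    (∀ h : C ⟶ H, ∃ (i : ℕ) (u : C ⟶ Q.obj (Xc i)),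
        u ≫ (Q.map (Sigma.ι Xc i) ≫ g) = h) ∧
    (∀ (i : ℕ) (u : C ⟶ Q.obj (Xc i)),
        u ≫ (Q.map (Sigma.ι Xc i) ≫ g) = 0 →
          ∃ j : ℕ, u ≫ transMap (fun n => Q.obj (Xc n)) α i j = 0) := by
  obtain ⟨n, hn⟩ := hunif
  have hGE : (∐ Xc).IsGE n := by
    rw [CochainComplex.isGE_iff]
    intro j hj
    refine aux_exact Xc j fun i => ?_
    rw [HomologicalComplex.exactAt_iff_isZero_homology]
    exact hn i j hj
  have hGE1 : ((∐ Xc)⟦(1 : ℤ)⟧).IsGE (n - 1) :=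
    CochainComplex.isGE_shift _ n 1 (n - 1) (by omega)
  -- finiteness
  have key : ∀ v : C ⟶ Q.obj (∐ Xc), ∃ N, v ≫ Q.map (partSum Xc N) = v := by
    intro v
    obtain ⟨N, hN⟩ := aux_main Cc (∐ Xc) hfg hproj hbdd n (partSum Xc) (aux_support Xc)
      (eC.inv ≫ v)
    refine ⟨N, ?_⟩
    rw [← cancel_epi eC.inv, ← Category.assoc, hN]
  have key1 : ∀ v : C ⟶ (Q.obj (∐ Xc))⟦(1 : ℤ)⟧,
      ∃ N, v ≫ (Q.map (partSum Xc N))⟦(1 : ℤ)⟧' = v := by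
    intro v
    obtain ⟨N, hN⟩ := aux_main Cc ((∐ Xc)⟦(1 : ℤ)⟧) hfg hproj hbdd (n - 1)
      (fun M => (partSum Xc M)⟦(1 : ℤ)⟧') (fun k x => aux_support Xc (k + 1) x)
      (eC.inv ≫ v ≫ (Q.commShiftIso (1 : ℤ)).inv.app (∐ Xc))
    refine ⟨N, ?_⟩
    rw [← cancel_epi eC.inv, ← cancel_mono ((Q.commShiftIso (1 : ℤ)).inv.app (∐ Xc)),
      Category.assoc, Category.assoc, Category.assoc, ← hN, Category.assoc, Category.assoc]
    congr 2
    exact ((Q.commShiftIso (1 : ℤ)).inv.naturality (partSum Xc N))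
  -- expansions
  have hsum : ∀ N, Q.map (partSum Xc N) =
      ∑ i ∈ Finset.range N, Q.map (Sigma.π Xc i) ≫ Q.map (Sigma.ι Xc i) := by
    intro N
    rw [partSum, Functor.map_sum]
    simp
  set φ := hc.desc (Cofan.mk (Q.obj (∐ Xc)) (fun i : ℕ =>
          Q.map (Sigma.ι Xc i) - (α i ≫ Q.map (Sigma.ι Xc (i + 1))))) with hφ
  have hιφ : ∀ i, Q.map (Sigma.ι Xc i) ≫ φ =
      Q.map (Sigma.ι Xc i) - (α i ≫ Q.map (Sigma.ι Xc (i + 1))) := fun i =>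
    hc.fac (Cofan.mk (Q.obj (∐ Xc)) (fun i : ℕ =>
          Q.map (Sigma.ι Xc i) - (α i ≫ Q.map (Sigma.ι Xc (i + 1))))) ⟨i⟩
  have hext : ∀ {Z : DerivedCategory (ModuleCat.{0} Λ)} (a b : Q.obj (∐ Xc) ⟶ Z),
      (∀ i, Q.map (Sigma.ι Xc i) ≫ a = Q.map (Sigma.ι Xc i) ≫ b) → a = b :=
    fun a b h => Cofan.IsColimit.hom_ext hc _ _ h
  have hιπ : ∀ i, Q.map (Sigma.ι Xc i) ≫ Q.map (Sigma.π Xc i) = 𝟙 _ := fun i => by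
    rw [← Functor.map_comp, Sigma.ι_π_eq_id, CategoryTheory.Functor.map_id]
  have hιπ' : ∀ i j, i ≠ j → Q.map (Sigma.ι Xc i) ≫ Q.map (Sigma.π Xc j) = 0 := fun i j h => by
    rw [← Functor.map_comp, Sigma.ι_π_of_ne _ h, Functor.map_zero]
  have hφ0 : φ ≫ Q.map (Sigma.π Xc 0) = Q.map (Sigma.π Xc 0) := by
    apply hext
    intro i
    rw [← Category.assoc, hιφ, Preadditive.sub_comp, Category.assoc, hιπ' (i + 1) 0 (by omega),
      comp_zero, sub_zero]
  have hφs : ∀ k, φ ≫ Q.map (Sigma.π Xc (k + 1)) =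
      Q.map (Sigma.π Xc (k + 1)) - Q.map (Sigma.π Xc k) ≫ α k := by
    intro k
    apply hext
    intro i
    rw [← Category.assoc, hιφ, Preadditive.sub_comp, Preadditive.comp_sub, Category.assoc]
    congr 1
    rw [← Category.assoc (Q.map (Sigma.ι Xc i))]
    by_cases h : i = k
    · subst h
      rw [hιπ, hιπ, Category.comp_id, Category.id_comp]
    · rw [hιπ' _ _ h, hιπ' _ _ (by omega), comp_zero, zero_comp]
  have hφg : φ ≫ g = 0 := comp_distTriang_mor_zero₁₂ _ htri
  have hstep : ∀ i, α i ≫ Q.map (Sigma.ι Xc (i + 1)) ≫ g = Q.map (Sigma.ι Xc i) ≫ g := by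
    intro i
    have h := hιφ i =≫ g
    rw [Category.assoc, hφg, comp_zero, Preadditive.sub_comp, Category.assoc] at h
    exact (sub_eq_zero.1 h.symm).symm
  refine ⟨fun i u => by rw [Category.assoc, hstep], fun h => ?_, fun i u hu => ?_⟩
  · have hδ : h ≫ δ = 0 := by
      obtain ⟨N, hN⟩ := key1 (h ≫ δ)
      have hz : (h ≫ δ) ≫ φ⟦(1 : ℤ)⟧' = 0 := by
        have h31 : δ ≫ φ⟦(1 : ℤ)⟧' = 0 := comp_distTriang_mor_zero₃₁ _ htri
        rw [Category.assoc, h31, comp_zero]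
      have hk : ∀ k, (h ≫ δ) ≫ (Q.map (Sigma.π Xc k))⟦(1 : ℤ)⟧' = 0 := by
        intro k
        induction k with
        | zero => rw [← hφ0, Functor.map_comp, ← Category.assoc, hz, zero_comp]
        | succ k ih =>
          have h1 := hφs k
          rw [eq_sub_iff_add_eq] at h1
          rw [← h1, Functor.map_add, Functor.map_comp, Functor.map_comp, Preadditive.comp_add,
            ← Category.assoc, hz, ← Category.assoc, ih, zero_comp, zero_comp, add_zero]
      rw [← hN, hsum, Functor.map_sum, Preadditive.comp_sum]
      refine Finset.sum_eq_zero fun i _ => ?_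
      rw [Functor.map_comp, ← Category.assoc, hk, zero_comp]
    obtain ⟨v, hv⟩ := Triangle.coyoneda_exact₃ _ htri h hδ
    change C ⟶ Q.obj (∐ Xc) at v
    change h = v ≫ g at hv
    obtain ⟨N, hN⟩ := key v
    have hind : ∀ N, ∃ u : C ⟶ Q.obj (Xc N),
        u ≫ Q.map (Sigma.ι Xc N) ≫ g = v ≫ Q.map (partSum Xc N) ≫ g := by
      intro N
      induction N with
      | zero => exact ⟨0, by simp [hsum]⟩
      | succ N ih =>
        obtain ⟨u, hu⟩ := ih
        refine ⟨(u + v ≫ Q.map (Sigma.π Xc N)) ≫ α N, ?_⟩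
        rw [Category.assoc, hstep, Preadditive.add_comp, hu, hsum, hsum, Finset.sum_range_succ,
          Preadditive.add_comp, Preadditive.comp_add]
        simp only [Category.assoc]
    obtain ⟨u, hu⟩ := hind N
    refine ⟨N, u, ?_⟩
    rw [hu, ← Category.assoc, hN, hv]
  · obtain ⟨w, hw⟩ := Triangle.coyoneda_exact₂ _ htri (u ≫ Q.map (Sigma.ι Xc i))
      ((Category.assoc _ _ _).trans hu)
    change C ⟶ Q.obj (∐ Xc) at w
    change u ≫ Q.map (Sigma.ι Xc i) = w ≫ φ at hw
    obtain ⟨N, hN⟩ := key w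
    have hwk : ∀ k, w ≫ Q.map (Sigma.π Xc (k + 1)) = (w ≫ Q.map (Sigma.π Xc k)) ≫ α k +
        u ≫ Q.map (Sigma.ι Xc i) ≫ Q.map (Sigma.π Xc (k + 1)) := by
      intro k
      have h2 := w ≫= hφs k
      rw [Preadditive.comp_sub, ← Category.assoc, ← hw, eq_sub_iff_add_eq] at h2
      rw [← h2]
      simp only [Category.assoc]
      exact add_comm _ _
    have hw0 : w ≫ Q.map (Sigma.π Xc 0) = u ≫ Q.map (Sigma.ι Xc i) ≫ Q.map (Sigma.π Xc 0) := by
      rw [← hφ0, ← Category.assoc, ← hw, Category.assoc, hφ0]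
    have hlt : ∀ k < i, w ≫ Q.map (Sigma.π Xc k) = 0 := by
      intro k
      induction k with
      | zero =>
        intro hk
        rw [hw0, hιπ' _ _ (by omega), comp_zero]
      | succ k ih =>
        intro hk
        rw [hwk, ih (by omega), hιπ' _ _ (by omega), comp_zero, zero_comp, add_zero]
    have hi : w ≫ Q.map (Sigma.π Xc i) = u := by
      cases i with
      | zero => rw [hw0, hιπ, Category.comp_id]
      | succ i => rw [hwk, hlt i (by omega), hιπ, Category.comp_id, zero_comp, zero_add]
    have htr : ∀ j, w ≫ Q.map (Sigma.π Xc (i + j)) =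
        u ≫ transMap (fun n => Q.obj (Xc n)) α i j := by
      intro j
      induction j with
      | zero => exact hi.trans (Category.comp_id u).symm
      | succ j ih =>
        refine (hwk (i + j)).trans ?_
        rw [ih, hιπ' _ _ (by omega), comp_zero, add_zero, Category.assoc]
        rfl
    refine ⟨N, ?_⟩
    rw [← htr, ← hN, Category.assoc, hsum, Preadditive.sum_comp, Preadditive.comp_sum]
    refine Finset.sum_eq_zero fun k hk => ?_
    have := Finset.mem_range.1 hk
    rw [Category.assoc, hιπ' _ _ (by omega), comp_zero, comp_zero]
end

section
/- Let Λ be a ring. In D(Mod Λ), the compact objects are precisely the objects isomorphic to bounded complexes of finitely generated projective Λ-modules. -/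
open CategoryTheory CategoryTheory.Limits DerivedCategory

/-- An object `C` of a preadditive category is compact if for every set-indexed
family of objects admitting a coproduct, the natural map
`⊕ᵢ Hom(C, Xᵢ) → Hom(C, ⊕ᵢ Xᵢ)` is an isomorphism. -/
def IsCompactObject {T : Type*} [Category T] [Preadditive T] (C : T) : Prop :=
  ∀ {ι : Type} [DecidableEq ι] (f : ι → T) (c : Cofan f), IsColimit c →
    Function.Bijective
      (DirectSum.toAddMonoid (fun i : ι => Preadditive.rightComp C (c.inj i)) :
        (DirectSum ι fun i : ι => (C ⟶ f i)) →+ (C ⟶ c.pt))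

set_option linter.unusedSectionVars false

namespace CptAux

noncomputable section

section Generic

variable {T : Type*} [Category T] [Preadditive T]

/-- projections from a coproduct -/
def cproj {ι : Type} [DecidableEq ι] {f : ι → T} {c : Cofan f} (hc : IsColimit c) (i : ι) :
    c.pt ⟶ f i :=
  Cofan.IsColimit.desc hc (fun j => if h : j = i then eqToHom (by rw [h]) else 0)

variable {ι : Type} [DecidableEq ι] {f : ι → T} {c : Cofan f} (hc : IsColimit c)

@[simp]
lemma inj_cproj (i : ι) : c.inj i ≫ cproj hc i = 𝟙 _ := by
  simp [cproj]

lemma inj_cproj_ne {i j : ι} (h : j ≠ i) : c.inj j ≫ cproj hc i = 0 := by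
  simp [cproj, h]

/-- partial idempotents -/
def cE (J : Finset ι) : c.pt ⟶ c.pt := ∑ i ∈ J, cproj hc i ≫ c.inj i

lemma inj_cE {i : ι} {J : Finset ι} (h : i ∈ J) : c.inj i ≫ cE hc J = c.inj i := by
  rw [cE, Preadditive.comp_sum, Finset.sum_eq_single i]
  · rw [← Category.assoc, inj_cproj, Category.id_comp]
  · intro j _ hj
    rw [← Category.assoc, inj_cproj_ne hc hj.symm, zero_comp]
  · intro h'; exact absurd h h'

lemma inj_cE_not {i : ι} {J : Finset ι} (h : i ∉ J) : c.inj i ≫ cE hc J = 0 := by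
  rw [cE, Preadditive.comp_sum, Finset.sum_eq_zero]
  intro j hj
  rw [← Category.assoc, inj_cproj_ne hc (by rintro rfl; exact h hj), zero_comp]

lemma cE_proj_not {i : ι} {J : Finset ι} (h : i ∉ J) : cE hc J ≫ cproj hc i = 0 := by
  rw [cE, Preadditive.sum_comp, Finset.sum_eq_zero]
  intro j hj
  rw [Category.assoc, inj_cproj_ne hc (by rintro rfl; exact h hj), comp_zero]

lemma cE_comp {J J' : Finset ι} (h : J ⊆ J') : cE hc J ≫ cE hc J' = cE hc J := by
  conv_lhs => rw [cE]
  conv_rhs => rw [cE]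
  rw [Preadditive.sum_comp]
  refine Finset.sum_congr rfl fun i hi => ?_
  rw [Category.assoc, inj_cE hc (h hi)]

lemma cE_mono {C : T} {g : C ⟶ c.pt} {J J' : Finset ι} (h : J ⊆ J') (hg : g ≫ cE hc J = g) :
    g ≫ cE hc J' = g := by
  rw [← hg, Category.assoc, cE_comp hc h]

/-- surjectivity form of compactness -/
def Cpt (C : T) : Prop :=
  ∀ ⦃ι : Type⦄ [DecidableEq ι] (f : ι → T) (c : Cofan f) (hc : IsColimit c) (g : C ⟶ c.pt),
    ∃ J : Finset ι, g ≫ cE hc J = g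

lemma rightComp_app {X Y Z : T} (g : Y ⟶ Z) (x : X ⟶ Y) :
    (Preadditive.rightComp X g) x = x ≫ g := rfl

lemma isCompactObject_iff (C : T) : IsCompactObject C ↔ Cpt C := by
  classical
  constructor
  · intro h ι _ f c hc g
    obtain ⟨x, rfl⟩ := (h f c hc).2 g
    induction x using DirectSum.induction_on with
    | zero => exact ⟨∅, by simp⟩
    | of i x => exact ⟨{i}, by simp [rightComp_app, inj_cE]⟩
    | add x y hx hy =>
      obtain ⟨J, hJ⟩ := hx
      obtain ⟨J', hJ'⟩ := hy
      refine ⟨J ∪ J', ?_⟩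
      rw [map_add, Preadditive.add_comp, cE_mono hc Finset.subset_union_left hJ,
        cE_mono hc Finset.subset_union_right hJ']
  · intro h ι _ f c hc
    constructor
    · rw [injective_iff_map_eq_zero]
      intro x hx
      have key : ∀ (x : DirectSum ι fun i : ι => (C ⟶ f i)) (i : ι),
          (DirectSum.toAddMonoid (fun i : ι => Preadditive.rightComp C (c.inj i)) x) ≫ cproj hc i
            = x i := by
        intro x i
        induction x using DirectSum.induction_on with
        | zero => simp
        | of j x =>
          by_cases hj : j = i
          · subst hj; simp [rightComp_app]
          · simp [rightComp_app, inj_cproj_ne hc hj, DirectSum.of_eq_of_ne _ _ _ (Ne.symm hj)]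
        | add x y hx hy =>
          rw [map_add, Preadditive.add_comp, hx, hy, DirectSum.add_apply]
      ext i
      rw [← key, hx, zero_comp]; rfl
    · intro g
      obtain ⟨J, hJ⟩ := h f c hc g
      refine ⟨∑ i ∈ J, DirectSum.of (fun i : ι => (C ⟶ f i)) i (g ≫ cproj hc i), ?_⟩
      rw [map_sum]
      conv_rhs => rw [← hJ]
      simp [rightComp_app, cE, Preadditive.comp_sum]

lemma Cpt.of_retract {C D : T} (hD : Cpt D) (i : C ⟶ D) (r : D ⟶ C) (hir : i ≫ r = 𝟙 C) :
    Cpt C := by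
  intro ι _ f c hc g
  obtain ⟨J, hJ⟩ := hD f c hc (r ≫ g)
  refine ⟨J, ?_⟩
  have := i ≫= hJ
  simpa only [← Category.assoc, hir, Category.id_comp] using this

lemma Cpt.of_iso {C D : T} (hD : Cpt D) (e : C ≅ D) : Cpt C := hD.of_retract e.hom e.inv (by simp)

end Generic

section Mapc
variable {T : Type*} [Category T] [Preadditive T]

/-- the shifted cofan -/
def mapCofan {S : Type*} [Category S] (F : T ⥤ S) {ι : Type} {f : ι → T} (c : Cofan f) :
    Cofan (fun i => F.obj (f i)) := Cofan.mk (F.obj c.pt) (fun i => F.map (c.inj i))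

/-- colimit property -/
def mapCofanIsColimit {S : Type*} [Category S] (F : T ⥤ S) {ι : Type} {f : ι → T}
    [PreservesColimit (Discrete.functor f) F] {c : Cofan f} (hc : IsColimit c) : IsColimit (mapCofan F c) :=
  isColimitCofanMkObjOfIsColimit F _ _ hc

lemma map_cproj {S : Type*} [Category S] [Preadditive S] (F : T ⥤ S) [F.Additive]
    {ι : Type} [DecidableEq ι] {f : ι → T}
    {c : Cofan f} (hc : IsColimit c) (hc' : IsColimit (mapCofan F c)) (i : ι) :
    cproj hc' i = F.map (cproj hc i) := by
  refine Cofan.IsColimit.hom_ext hc' _ _ fun j => ?_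
  change _ = F.map (c.inj j) ≫ F.map _
  rw [← F.map_comp]
  by_cases h : j = i
  · subst h; simp [inj_cproj]
  · rw [inj_cproj_ne _ h, inj_cproj_ne _ h, F.map_zero]

lemma map_cE {S : Type*} [Category S] [Preadditive S] (F : T ⥤ S) [F.Additive]
    {ι : Type} [DecidableEq ι] {f : ι → T}
    {c : Cofan f} (hc : IsColimit c) (hc' : IsColimit (mapCofan F c)) (J : Finset ι) :
    cE hc' J = F.map (cE hc J) := by
  simp only [cE, F.map_sum, F.map_comp, map_cproj F hc hc']
  rfl

end Mapc

section Tri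
open Pretriangulated
variable {T : Type*} [Category T] [Preadditive T] [HasZeroObject T] [HasShift T ℤ]
  [∀ n : ℤ, (shiftFunctor T n).Additive] [Pretriangulated T]

lemma Cpt.shift {C : T} (hC : Cpt C) (n : ℤ) : Cpt (C⟦n⟧) := by
  intro ι _ f c hc g
  let F := shiftFunctor T (-n)
  let e : C⟦n⟧⟦-n⟧ ≅ C := (shiftEquiv T n).unitIso.symm.app C
  obtain ⟨J, hJ⟩ := hC _ _ (mapCofanIsColimit F hc) (e.inv ≫ F.map g)
  refine ⟨J, F.map_injective ?_⟩
  rw [map_cE F hc] at hJ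
  rw [← cancel_epi e.inv, F.map_comp, ← Category.assoc]
  exact hJ

lemma Cpt.shift_fac {C : T} (hC : Cpt C) {ι : Type} [DecidableEq ι] {f : ι → T}
    {c : Cofan f} (hc : IsColimit c) (n : ℤ) (g : C ⟶ c.pt⟦n⟧) :
    ∃ J : Finset ι, g ≫ (cE hc J)⟦n⟧' = g := by
  obtain ⟨J, hJ⟩ := hC _ _ (mapCofanIsColimit (shiftFunctor T n) hc) g
  exact ⟨J, by rwa [map_cE (shiftFunctor T n) hc] at hJ⟩

lemma Cpt.cone (A : Triangle T) (hA : A ∈ distTriang T) (h₁ : Cpt A.obj₁) (h₂ : Cpt A.obj₂) :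
    Cpt A.obj₃ := by
  intro ι _ f c hc g
  obtain ⟨J, hJ⟩ := h₂ f c hc (A.mor₂ ≫ g)
  obtain ⟨h, hh⟩ := A.yoneda_exact₃ hA (g - g ≫ cE hc J) (by
    rw [Preadditive.comp_sub, ← Category.assoc, hJ, sub_self])
  obtain ⟨J', hJ'⟩ := (h₁.shift 1) f c hc h
  refine ⟨J ∪ J', ?_⟩
  have h1 : (g - g ≫ cE hc J) ≫ cE hc (J ∪ J') = g - g ≫ cE hc J := by
    rw [hh, Category.assoc, cE_mono hc Finset.subset_union_right hJ']
  rw [Preadditive.sub_comp, Category.assoc, cE_comp hc Finset.subset_union_left] at h1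
  exact sub_left_injective h1

end Tri
end
end CptAux



namespace CptAux
noncomputable section
section Complexes
variable {Λ : Type} [Ring Λ]

lemma mod_fin {ι : Type} [DecidableEq ι] {f : ι → ModuleCat.{0} Λ} {c : Cofan f}
    (hc : IsColimit c) (z : c.pt) : ∃ J : Finset ι, (cE hc J).hom z = z := by
  have mono : ∀ {J J' : Finset ι} (_ : J ⊆ J') {z : c.pt} (_ : (cE hc J).hom z = z),
      (cE hc J').hom z = z := by
    intro J J' h z hz
    have h1 := cE_comp hc h
    have h2 := congrArg (fun φ => φ.hom z) h1
    simp only [ModuleCat.hom_comp, LinearMap.comp_apply, hz] at h2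
    exact h2
  let N : Submodule Λ c.pt :=
    { carrier := {z | ∃ J : Finset ι, (cE hc J).hom z = z}
      zero_mem' := ⟨∅, by simp⟩
      add_mem' := by
        rintro a b ⟨J, hJ⟩ ⟨J', hJ'⟩
        exact ⟨J ∪ J', by
          rw [map_add, mono Finset.subset_union_left hJ, mono Finset.subset_union_right hJ']⟩
      smul_mem' := by
        rintro r a ⟨J, hJ⟩
        exact ⟨J, by rw [map_smul, hJ]⟩ }
  have h0 : ModuleCat.ofHom N.mkQ = 0 := by
    refine Cofan.IsColimit.hom_ext hc _ _ fun i => ?_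
    ext x
    simp only [ModuleCat.hom_comp, LinearMap.comp_apply, comp_zero, ModuleCat.hom_zero,
      LinearMap.zero_apply, ModuleCat.hom_ofHom]
    rw [Submodule.mkQ_apply, Submodule.Quotient.mk_eq_zero]
    refine ⟨{i}, ?_⟩
    have h2 := congrArg (fun φ => φ.hom x) (inj_cE hc (Finset.mem_singleton_self i))
    simpa only [ModuleCat.hom_comp, LinearMap.comp_apply] using h2
  have h1 : N.mkQ z = 0 := by
    have := congrArg (fun φ => φ.hom z) h0
    simpa using this
  rw [Submodule.mkQ_apply, Submodule.Quotient.mk_eq_zero] at h1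
  exact h1

variable {ι : Type} [DecidableEq ι] {f : ι → CochainComplex (ModuleCat.{0} Λ) ℤ} {c : Cofan f}
    (hc : IsColimit c)

lemma cx_fin (n : ℤ) (z : c.pt.X n) : ∃ J : Finset ι, ((cE hc J).f n).hom z = z := by
  let F := HomologicalComplex.eval (ModuleCat.{0} Λ) (ComplexShape.up ℤ) n
  obtain ⟨J, hJ⟩ := mod_fin (mapCofanIsColimit F hc) z
  refine ⟨J, ?_⟩
  rw [map_cE F hc] at hJ
  exact hJ

lemma cx_fin_fg (n : ℤ) {M : ModuleCat.{0} Λ} [Module.Finite Λ M] (g : M ⟶ c.pt.X n) :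
    ∃ J : Finset ι, g ≫ ((cE hc J).f n) = g := by
  obtain ⟨S, hS⟩ := Module.Finite.fg_top (R := Λ) (M := M)
  choose J hJ using fun m => cx_fin hc n (g.hom m)
  refine ⟨S.biUnion J, ?_⟩
  ext m
  have hm : m ∈ Submodule.span Λ (S : Set M) := by rw [hS]; trivial
  induction hm using Submodule.span_induction with
  | zero => simp
  | add x y _ _ hx hy => rw [map_add, map_add, hx, hy]
  | smul r x _ hx => rw [map_smul, map_smul, hx]
  | mem x hx =>
    have h1 := congrArg (fun φ => (φ.f n).hom (g.hom x))
      (cE_comp hc (Finset.subset_biUnion_of_mem J hx))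
    simpa only [HomologicalComplex.comp_f, ModuleCat.hom_comp, LinearMap.comp_apply, hJ] using h1

lemma cx_hom_fin (n : ℤ) (h : c.pt.homology n) : ∃ J : Finset ι,
    (HomologicalComplex.homologyMap (cE hc J) n).hom h = h := by
  obtain ⟨y, rfl⟩ := (ModuleCat.epi_iff_surjective _).1
    (inferInstance : Epi (c.pt.homologyπ n)) h
  obtain ⟨J, hJ⟩ := cx_fin hc n ((c.pt.iCycles n).hom y)
  refine ⟨J, ?_⟩
  have h1 : (HomologicalComplex.cyclesMap (cE hc J) n).hom y = y := by
    apply (ModuleCat.mono_iff_injective _).1 (inferInstance : Mono (c.pt.iCycles n))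
    have := congrArg (fun φ => φ.hom y) (HomologicalComplex.cyclesMap_i (cE hc J) n)
    simp only [ModuleCat.hom_comp, LinearMap.comp_apply, hJ] at this
    exact this
  have := congrArg (fun φ => φ.hom y) (HomologicalComplex.homologyπ_naturality (cE hc J) n)
  simp only [ModuleCat.hom_comp, LinearMap.comp_apply, h1] at this
  exact this

lemma homologyMap_cE (n : ℤ) (J : Finset ι) :
    HomologicalComplex.homologyMap (cE hc J) n = ∑ i ∈ J,
      HomologicalComplex.homologyMap (cproj hc i) n ≫
        HomologicalComplex.homologyMap (c.inj i) n := by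
  have := (HomologicalComplex.homologyFunctor (ModuleCat.{0} Λ) (ComplexShape.up ℤ) n).map_sum
    (fun i => cproj hc i ≫ c.inj i) J
  simp only [HomologicalComplex.homologyFunctor_map, HomologicalComplex.homologyMap_comp] at this
  exact this

/-- A coproduct of quasi-isomorphisms is a quasi-isomorphism. -/
lemma quasiIso_coprod (hc : IsColimit c) {f' : ι → CochainComplex (ModuleCat.{0} Λ) ℤ} {c' : Cofan f'}
    (hc' : IsColimit c') (s : ∀ i, f i ⟶ f' i) (hs : ∀ i, QuasiIso (s i)) (t : c.pt ⟶ c'.pt)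
    (ht : ∀ i, c.inj i ≫ t = s i ≫ c'.inj i) : QuasiIso t := by
  have ht' : ∀ i, t ≫ cproj hc' i = cproj hc i ≫ s i := by
    intro i
    refine Cofan.IsColimit.hom_ext hc _ _ fun j => ?_
    rw [← Category.assoc, ht, ← Category.assoc, Category.assoc]
    by_cases h : j = i
    · subst h; simp
    · rw [inj_cproj_ne _ h, inj_cproj_ne _ h]; simp
  rw [quasiIso_iff]
  intro n
  rw [quasiIsoAt_iff_isIso_homologyMap]
  have hsi : ∀ i, IsIso (HomologicalComplex.homologyMap (s i) n) := fun i => by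
    have := hs i; infer_instance
  have := fun i => (ConcreteCategory.isIso_iff_bijective _).1 (hsi i)
  rw [ConcreteCategory.isIso_iff_bijective]
  constructor
  · rw [injective_iff_map_eq_zero]
    intro h hh
    obtain ⟨J, hJ⟩ := cx_hom_fin hc n h
    rw [← hJ, homologyMap_cE]
    simp only [ModuleCat.hom_sum, LinearMap.sum_apply, ModuleCat.hom_comp, LinearMap.comp_apply]
    refine Finset.sum_eq_zero fun i _ => ?_
    have h0 : (HomologicalComplex.homologyMap (cproj hc i) n).hom h = 0 := by
      apply (this i).1
      have h1 := congrArg (fun φ : c.pt ⟶ f' i => (HomologicalComplex.homologyMap φ n).hom h) (ht' i)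
      simp only [HomologicalComplex.homologyMap_comp, ModuleCat.hom_comp,
        LinearMap.comp_apply] at h1
      rw [map_zero]
      refine h1.symm.trans ?_
      refine (congrArg _ hh).trans ?_
      rw [map_zero]
    rw [h0, map_zero]
  · intro h
    obtain ⟨J, hJ⟩ := cx_hom_fin hc' n h
    choose g hg using fun i => (this i).2
      ((HomologicalComplex.homologyMap (cproj hc' i) n).hom h)
    refine ⟨∑ i ∈ J, (HomologicalComplex.homologyMap (c.inj i) n).hom (g i), ?_⟩
    rw [map_sum, ← hJ, homologyMap_cE]
    simp only [ModuleCat.hom_sum, LinearMap.sum_apply, ModuleCat.hom_comp, LinearMap.comp_apply]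
    refine Finset.sum_congr rfl fun i _ => ?_
    have h1 := congrArg (fun φ : f i ⟶ c'.pt => (HomologicalComplex.homologyMap φ n).hom (g i)) (ht i)
    simp only [HomologicalComplex.homologyMap_comp, ModuleCat.hom_comp,
        LinearMap.comp_apply] at h1
    refine h1.trans ?_
    exact congrArg _ (hg i)

end Complexes
end
end CptAux



namespace CptAux
noncomputable section
section QCoprod
variable {Λ : Type} [Ring Λ]

lemma homotopy_coprod {ι : Type} {f : ι → CochainComplex (ModuleCat.{0} Λ) ℤ} {c : Cofan f}
    (hc : IsColimit c) {K : CochainComplex (ModuleCat.{0} Λ) ℤ} (t : c.pt ⟶ K)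
    (h : ∀ i, Nonempty (Homotopy (c.inj i ≫ t) 0)) : Nonempty (Homotopy t 0) := by
  have h := fun i => (h i).some
  let hcn := fun n : ℤ => mapCofanIsColimit
    (HomologicalComplex.eval (ModuleCat.{0} Λ) (ComplexShape.up ℤ) n) hc
  let hom : ∀ i j : ℤ, c.pt.X i ⟶ K.X j := fun i j =>
    Cofan.IsColimit.desc (hcn i) (fun k => (h k).hom i j)
  have hhom : ∀ k i j, (c.inj k).f i ≫ hom i j = (h k).hom i j := fun k i j =>
    Cofan.IsColimit.fac (hcn i) (fun k => (h k).hom i j) k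
  refine ⟨⟨hom, ?_, ?_⟩⟩
  · intro i j hij
    refine Cofan.IsColimit.hom_ext (hcn i) _ _ fun k => ?_
    refine (hhom k i j).trans ?_
    rw [(h k).zero i j hij]
    exact (comp_zero (f := (c.inj k).f i)).symm
  · intro i
    refine Cofan.IsColimit.hom_ext (hcn i) _ _ fun k => ?_
    have r1 : (ComplexShape.up ℤ).Rel i (i+1) := by simp
    have r2 : (ComplexShape.up ℤ).Rel (i-1) i := by simp
    have h1 := (h k).comm i
    rw [dNext_eq _ r1, prevD_eq _ r2] at h1 ⊢
    change (c.inj k).f i ≫ _ = (c.inj k).f i ≫ _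
    rw [HomologicalComplex.zero_f, add_zero, Preadditive.comp_add] at *
    rw [← Category.assoc ((c.inj k).f i), ← Category.assoc ((c.inj k).f i), hhom,
      HomologicalComplex.Hom.comm, Category.assoc, hhom]
    exact h1

variable [HasDerivedCategory (ModuleCat.{0} Λ)]

lemma Q_map_eq_zero {X Y : CochainComplex (ModuleCat.{0} Λ) ℤ} (a : X ⟶ Y)
    (h : (Q (C := ModuleCat.{0} Λ)).map a = 0) :
    ∃ (X' : CochainComplex (ModuleCat.{0} Λ) ℤ) (t : X' ⟶ X), QuasiIso t ∧
      Nonempty (Homotopy (t ≫ a) 0) := by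
  have h1 : (Qh (C := ModuleCat.{0} Λ)).map ((HomotopyCategory.quotient _ _).map a) =
      (Qh (C := ModuleCat.{0} Λ)).map 0 := by
    rw [Functor.map_zero]
    have := quotientCompQhIso_hom_naturality a
    rw [h, comp_zero] at this
    rwa [Preadditive.IsIso.comp_right_eq_zero] at this
  rw [MorphismProperty.map_eq_iff_precomp Qh (HomotopyCategory.quasiIso _ (ComplexShape.up ℤ))]
    at h1
  obtain ⟨X', t, ht, h2⟩ := h1
  obtain ⟨X', rfl⟩ := HomotopyCategory.quotient_obj_surjective X'
  obtain ⟨t, rfl⟩ := (HomotopyCategory.quotient _ _).map_surjective t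
  refine ⟨X', t, ?_, ?_⟩
  · rw [HomotopyCategory.quotient_map_mem_quasiIso_iff] at ht
    exact ht
  · rw [comp_zero, ← Functor.map_comp] at h2
    exact (HomotopyCategory.quotient_map_eq_zero_iff _).1 h2

lemma Q_coprod_ext {ι : Type} [DecidableEq ι] {f : ι → CochainComplex (ModuleCat.{0} Λ) ℤ}
    {c : Cofan f} (hc : IsColimit c) {Y : DerivedCategory (ModuleCat.{0} Λ)}
    (g : Q.obj c.pt ⟶ Y) (hg : ∀ i, Q.map (c.inj i) ≫ g = 0) : g = 0 := by
  obtain ⟨Y', ⟨e⟩⟩ : ∃ Y', Nonempty (Q.obj Y' ≅ Y) := ⟨_, ⟨Q.objObjPreimageIso Y⟩⟩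
  obtain ⟨Z, a, s, hs, hfac⟩ := left_fac (g ≫ e.inv)
  have h1 : ∀ i, Q.map (c.inj i ≫ a) = 0 := by
    intro i
    have : Q.map (c.inj i) ≫ g ≫ e.inv = 0 := by rw [← Category.assoc, hg, zero_comp]
    rw [hfac, ← Category.assoc, ← Functor.map_comp] at this
    rwa [Preadditive.IsIso.comp_right_eq_zero] at this
  choose X' t ht hth using fun i => Q_map_eq_zero _ (h1 i)
  let c' := coproductIsCoproduct X'
  let τ : (Cofan.mk (∐ X') (Sigma.ι X')).pt ⟶ c.pt :=
    Cofan.IsColimit.desc c' (fun i => t i ≫ c.inj i)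
  have hτ : ∀ i, Cofan.inj (Cofan.mk (∐ X') (Sigma.ι X')) i ≫ τ = t i ≫ c.inj i :=
    fun i => Cofan.IsColimit.fac c' _ i
  have hq : QuasiIso τ := quasiIso_coprod c' hc t ht τ hτ
  have h2 : Nonempty (Homotopy (τ ≫ a) 0) := homotopy_coprod c' _ (fun i => by
    rw [← Category.assoc, hτ, Category.assoc]; exact hth i)
  have h3 := Q_map_eq_of_homotopy _ h2.some
  rw [Functor.map_zero, Functor.map_comp, Preadditive.IsIso.comp_left_eq_zero] at h3
  rw [h3, zero_comp, Preadditive.IsIso.comp_right_eq_zero] at hfac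
  exact hfac

lemma Q_coprod_uniq {ι : Type} [DecidableEq ι] {f : ι → CochainComplex (ModuleCat.{0} Λ) ℤ}
    {c : Cofan f} (hc : IsColimit c) {Y : DerivedCategory (ModuleCat.{0} Λ)}
    (g g' : Q.obj c.pt ⟶ Y) (hg : ∀ i, Q.map (c.inj i) ≫ g = Q.map (c.inj i) ≫ g') :
    g = g' := by
  rw [← sub_eq_zero]
  apply Q_coprod_ext hc
  intro i
  rw [Preadditive.comp_sub, hg, sub_self]

lemma Q_coprod_desc {ι : Type} [DecidableEq ι] {f : ι → CochainComplex (ModuleCat.{0} Λ) ℤ}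
    {c : Cofan f} (hc : IsColimit c) {Y : DerivedCategory (ModuleCat.{0} Λ)}
    (g : ∀ i, Q.obj (f i) ⟶ Y) : ∃ g' : Q.obj c.pt ⟶ Y, ∀ i, Q.map (c.inj i) ≫ g' = g i := by
  obtain ⟨Y', ⟨e⟩⟩ : ∃ Y', Nonempty (Q.obj Y' ≅ Y) := ⟨_, ⟨Q.objObjPreimageIso Y⟩⟩
  choose X' s hs a hfac using fun i => right_fac (g i ≫ e.inv)
  let c' := coproductIsCoproduct X'
  let τ : (Cofan.mk (∐ X') (Sigma.ι X')).pt ⟶ c.pt :=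
    Cofan.IsColimit.desc c' (fun i => s i ≫ c.inj i)
  have hτ : ∀ i, Cofan.inj (Cofan.mk (∐ X') (Sigma.ι X')) i ≫ τ = s i ≫ c.inj i :=
    fun i => Cofan.IsColimit.fac c' _ i
  have hq : QuasiIso τ := quasiIso_coprod c' hc s
    (fun i => (isIso_Q_map_iff_quasiIso _ _).1 (hs i)) τ hτ
  let α : (Cofan.mk (∐ X') (Sigma.ι X')).pt ⟶ Y' := Cofan.IsColimit.desc c' a
  have hα : ∀ i, Cofan.inj (Cofan.mk (∐ X') (Sigma.ι X')) i ≫ α = a i :=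
    fun i => Cofan.IsColimit.fac c' _ i
  refine ⟨inv (Q.map τ) ≫ Q.map α ≫ e.hom, fun i => ?_⟩
  have := hs i
  rw [← cancel_mono e.inv, hfac, ← cancel_epi (Q.map (s i))]
  simp only [← Category.assoc]
  rw [← Functor.map_comp, ← hτ, Functor.map_comp]
  simp only [Category.assoc, IsIso.hom_inv_id_assoc, Iso.hom_inv_id, Category.comp_id]
  rw [← Functor.map_comp, hα]

/-- `Q` preserves coproducts -/
def QCoprod {ι : Type} [DecidableEq ι] {f : ι → CochainComplex (ModuleCat.{0} Λ) ℤ}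
    {c : Cofan f} (hc : IsColimit c) : IsColimit (mapCofan (Q (C := ModuleCat.{0} Λ)) c) :=
  Cofan.IsColimit.mk _ (fun s => (Q_coprod_desc hc s.inj).choose)
    (fun s i => (Q_coprod_desc hc s.inj).choose_spec i)
    (fun s m hm => by
      exact Q_coprod_uniq hc _ _ (fun i => (hm i).trans
        ((Q_coprod_desc hc s.inj).choose_spec i).symm))

/-- the coproduct cofan of complexes -/
abbrev cxCofan {ι : Type} (f : ι → CochainComplex (ModuleCat.{0} Λ) ℤ) : Cofan f :=
  Cofan.mk (∐ f) (Sigma.ι f)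

/-- it is a colimit -/
abbrev cxColim {ι : Type} (f : ι → CochainComplex (ModuleCat.{0} Λ) ℤ) : IsColimit (cxCofan f) :=
  coproductIsCoproduct f

/-- transporting a coproduct along isomorphisms -/
def isoCofan {T : Type*} [Category T] {ι : Type} {f f' : ι → T} (e : ∀ i, f' i ≅ f i)
    {c : Cofan f'} (hc : IsColimit c) :
    IsColimit (Cofan.mk c.pt (fun i => (e i).inv ≫ c.inj i) : Cofan f) :=
  Cofan.IsColimit.mk _ (fun s => Cofan.IsColimit.desc hc (fun i => (e i).hom ≫ s.inj i))
    (fun s i => by simp) (fun s m hm => by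
      refine Cofan.IsColimit.hom_ext hc _ _ fun i => ?_
      rw [Cofan.IsColimit.fac, ← hm i]
      simp)

lemma exists_coprod {ι : Type} (f : ι → DerivedCategory (ModuleCat.{0} Λ)) :
    ∃ c : Cofan f, Nonempty (IsColimit c) := by
  classical
  exact ⟨_, ⟨isoCofan (fun i => Q.objObjPreimageIso (f i)) (QCoprod (cxColim _))⟩⟩

end QCoprod
end
end CptAux



namespace CptAux
noncomputable section
section KProj
variable {Λ : Type} [Ring Λ]

lemma cE_iso {T : Type*} [Category T] [Preadditive T] {ι : Type} [DecidableEq ι] {f f' : ι → T}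
    (e : ∀ i, f' i ≅ f i) {c : Cofan f} (hc : IsColimit c) {c' : Cofan f'} (hc' : IsColimit c')
    (u : c.pt ⟶ c'.pt) (hu : ∀ i, c.inj i ≫ u = (e i).inv ≫ c'.inj i) (J : Finset ι) :
    cE hc J ≫ u = u ≫ cE hc' J := by
  refine Cofan.IsColimit.hom_ext hc _ _ fun i => ?_
  rw [← Category.assoc, ← Category.assoc, hu, Category.assoc (e i).inv]
  by_cases h : i ∈ J
  · rw [inj_cE _ h, inj_cE _ h, hu]
  · rw [inj_cE_not _ h, inj_cE_not _ h]; simp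

variable [HasDerivedCategory (ModuleCat.{0} Λ)]

lemma Cpt.of_Q {C : DerivedCategory (ModuleCat.{0} Λ)}
    (h : ∀ {ι : Type} [DecidableEq ι] (X : ι → CochainComplex (ModuleCat.{0} Λ) ℤ)
      (g : C ⟶ Q.obj (cxCofan X).pt), ∃ J : Finset ι, g ≫ Q.map (cE (cxColim X) J) = g) :
    Cpt C := by
  intro ι _ f c hc g
  let X := fun i => Q.objPreimage (f i)
  let e : ∀ i, Q.obj (X i) ≅ f i := fun i => Q.objObjPreimageIso (f i)
  let hc' := isoCofan e (QCoprod (cxColim X))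
  let u : c.pt ≅ Q.obj (cxCofan X).pt := hc.coconePointUniqueUpToIso hc'
  have hu : ∀ i, c.inj i ≫ u.hom = (e i).inv ≫ (mapCofan Q (cxCofan X)).inj i :=
    fun i => hc.comp_coconePointUniqueUpToIso_hom hc' ⟨i⟩
  obtain ⟨J, hJ⟩ := h X (g ≫ u.hom)
  refine ⟨J, ?_⟩
  have h1 := cE_iso e hc (QCoprod (cxColim X)) u.hom hu J
  rw [map_cE Q (cxColim X)] at h1
  have h2 : u.hom ≫ Q.map (cE (cxColim X) J) = cE hc J ≫ u.hom := h1.symm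
  rw [Category.assoc, h2, ← Category.assoc] at hJ
  exact (cancel_mono u.hom).1 hJ

lemma lift_chain {P X : CochainComplex (ModuleCat.{0} Λ) ℤ}
    (hP : ∀ n, Module.Projective Λ (P.X n)) {b : ℤ} (hb : ∀ n, b < n → IsZero (P.X n))
    (g : Q.obj P ⟶ Q.obj X) : ∃ φ : P ⟶ X, Q.map φ = g := by
  have : ∀ n, CategoryTheory.Projective (P.X n) := fun n =>
    (IsProjective.iff_projective (R := Λ) (P.X n)).1 (hP n)
  have : P.IsStrictlyLE b := by
    rw [CochainComplex.isStrictlyLE_iff]; exact hb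
  have := CochainComplex.isKProjective_of_projective P b
  obtain ⟨ψ, hψ⟩ := (CochainComplex.IsKProjective.Qh_map_bijective P
    ((HomotopyCategory.quotient _ _).obj X)).2
    ((quotientCompQhIso _).hom.app P ≫ g ≫ (quotientCompQhIso _).inv.app X)
  obtain ⟨φ, rfl⟩ := (HomotopyCategory.quotient _ _).map_surjective ψ
  refine ⟨φ, ?_⟩
  have h1 := quotientCompQhIso_hom_naturality φ
  have h2 : (quotientCompQhIso (ModuleCat.{0} Λ)).hom.app P ≫ Q.map φ =
     (quotientCompQhIso (ModuleCat.{0} Λ)).hom.app P ≫ g := by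
    rw [← h1, hψ]; simp
  exact (cancel_epi _).1 h2

/-- bounded complexes of f.g. projectives, with bounds -/
structure Bfp (P : CochainComplex (ModuleCat.{0} Λ) ℤ) (a b : ℤ) : Prop where
  fin : ∀ n, Module.Finite Λ (P.X n)
  proj : ∀ n, Module.Projective Λ (P.X n)
  lt : ∀ n, n < a → IsZero (P.X n)
  gt : ∀ n, b < n → IsZero (P.X n)

/-- perfect objects -/
def Perf (C : DerivedCategory (ModuleCat.{0} Λ)) : Prop :=
  ∃ (P : CochainComplex (ModuleCat.{0} Λ) ℤ) (a b : ℤ), Bfp P a b ∧ Nonempty (C ≅ Q.obj P)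

lemma Bfp.perf {P : CochainComplex (ModuleCat.{0} Λ) ℤ} {a b : ℤ} (h : Bfp P a b) :
    Perf (Q.obj P) := ⟨P, a, b, h, ⟨Iso.refl _⟩⟩

lemma Perf.of_iso {C C' : DerivedCategory (ModuleCat.{0} Λ)} (h : Perf C) (e : C' ≅ C) :
    Perf C' := by
  obtain ⟨P, a, b, hP, ⟨e'⟩⟩ := h
  exact ⟨P, a, b, hP, ⟨e ≪≫ e'⟩⟩

lemma Bfp.cpt {P : CochainComplex (ModuleCat.{0} Λ) ℤ} {a b : ℤ} (hP : Bfp P a b) :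
    Cpt (Q.obj P) := by
  apply Cpt.of_Q
  intro ι _ X g
  obtain ⟨φ, rfl⟩ := lift_chain hP.proj hP.gt g
  have := hP.fin
  choose J hJ using fun n => cx_fin_fg (cxColim X) n (φ.f n)
  refine ⟨(Finset.Icc a b).biUnion J, ?_⟩
  rw [← Functor.map_comp]
  congr 1
  ext1 n
  rw [HomologicalComplex.comp_f]
  by_cases h1 : n < a
  · exact (hP.lt n h1).eq_of_src _ _
  by_cases h2 : b < n
  · exact (hP.gt n h2).eq_of_src _ _
  have h3 : J n ⊆ (Finset.Icc a b).biUnion J :=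
    Finset.subset_biUnion_of_mem J (Finset.mem_Icc.2 ⟨by omega, by omega⟩)
  have h4 := congrArg (fun ψ => ψ.f n) (cE_comp (cxColim X) h3)
  simp only [HomologicalComplex.comp_f] at h4
  rw [← hJ n, Category.assoc, h4]

lemma Perf.cpt {C : DerivedCategory (ModuleCat.{0} Λ)} (h : Perf C) : Cpt C := by
  obtain ⟨P, a, b, hP, ⟨e⟩⟩ := h
  exact hP.cpt.of_iso e

end KProj
end
end CptAux



namespace CptAux
noncomputable section
section PerfClosure
open Pretriangulated ZeroObject
variable {Λ : Type} [Ring Λ]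

lemma fin_of_iso {M N : ModuleCat.{0} Λ} (e : M ≅ N) (h : Module.Finite Λ M) :
    Module.Finite Λ N := Module.Finite.equiv e.toLinearEquiv

lemma proj_of_iso {M N : ModuleCat.{0} Λ} (e : M ≅ N) (h : Module.Projective Λ M) :
    Module.Projective Λ N := Module.Projective.of_equiv e.toLinearEquiv

lemma fin_of_zero {M : ModuleCat.{0} Λ} (h : IsZero M) : Module.Finite Λ M := by
  have := ModuleCat.subsingleton_of_isZero h
  infer_instance

lemma proj_of_zero {M : ModuleCat.{0} Λ} (h : IsZero M) : Module.Projective Λ M := by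
  have := ModuleCat.subsingleton_of_isZero h
  exact Module.Projective.of_free

/-- single complex -/
abbrev sg (k : ℤ) (M : ModuleCat.{0} Λ) : CochainComplex (ModuleCat.{0} Λ) ℤ :=
  (HomologicalComplex.single (ModuleCat.{0} Λ) (ComplexShape.up ℤ) k).obj M

lemma Bfp.single (k : ℤ) (M : ModuleCat.{0} Λ) [hM : Module.Finite Λ M]
    [hM' : Module.Projective Λ M] : Bfp (sg k M) k k where
  fin n := by
    by_cases h : n = k
    · subst h
      exact fin_of_iso (HomologicalComplex.singleObjXSelf _ n M).symm hM
    · exact fin_of_zero (HomologicalComplex.isZero_single_obj_X _ _ _ _ h)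
  proj n := by
    by_cases h : n = k
    · subst h
      exact proj_of_iso (HomologicalComplex.singleObjXSelf _ n M).symm hM'
    · exact proj_of_zero (HomologicalComplex.isZero_single_obj_X _ _ _ _ h)
  lt n hn := HomologicalComplex.isZero_single_obj_X _ _ _ _ (by omega)
  gt n hn := HomologicalComplex.isZero_single_obj_X _ _ _ _ (by omega)

lemma Bfp.shift {P : CochainComplex (ModuleCat.{0} Λ) ℤ} {a b : ℤ} (h : Bfp P a b) (n : ℤ) :
    Bfp (P⟦n⟧) (a - n) (b - n) where
  fin i := h.fin (i + n)
  proj i := h.proj (i + n)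
  lt i hi := h.lt (i + n) (by omega)
  gt i hi := h.gt (i + n) (by omega)

/-- terms of the mapping cone -/
def mcX {P P' : CochainComplex (ModuleCat.{0} Λ) ℤ} (φ : P ⟶ P') (n : ℤ) :
    ModuleCat.of Λ (P.X (n + 1) × P'.X n) ≅ (CochainComplex.mappingCone φ).X n :=
  (HomologicalComplex.homotopyCofiber.XIsoBiprod φ n (n+1) (by simp) ≪≫
    ModuleCat.biprodIsoProd _ _).symm

lemma Bfp.cone {P P' : CochainComplex (ModuleCat.{0} Λ) ℤ} {a b a' b' : ℤ} (h : Bfp P a b)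
    (h' : Bfp P' a' b') (φ : P ⟶ P') :
    Bfp (CochainComplex.mappingCone φ) (min (a - 1) a') (max (b - 1) b') where
  fin n := by
    refine fin_of_iso (mcX φ n) ?_
    have := h.fin (n+1)
    have := h'.fin n
    change Module.Finite Λ (_ × _)
    infer_instance
  proj n := by
    refine proj_of_iso (mcX φ n) ?_
    have := h.proj (n+1)
    have := h'.proj n
    change Module.Projective Λ (_ × _)
    infer_instance
  lt n hn := by
    refine HomologicalComplex.homotopyCofiber.isZero_X φ _ (h'.lt _ (by omega)) ?_
    intro j hj
    simp at hj
    exact h.lt _ (by omega)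
  gt n hn := by
    refine HomologicalComplex.homotopyCofiber.isZero_X φ _ (h'.gt _ (by omega)) ?_
    intro j hj
    simp at hj
    exact h.gt _ (by omega)

variable [HasDerivedCategory (ModuleCat.{0} Λ)]

lemma Perf.shift {C : DerivedCategory (ModuleCat.{0} Λ)} (h : Perf C) (n : ℤ) :
    Perf (C⟦n⟧) := by
  obtain ⟨P, a, b, hP, ⟨e⟩⟩ := h
  exact (hP.shift n).perf.of_iso ((shiftFunctor _ n).mapIso e ≪≫ ((Q.commShiftIso n).app P).symm)

lemma Perf.cone (A : Triangle (DerivedCategory (ModuleCat.{0} Λ))) (hA : A ∈ distTriang _)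
    (h₁ : Perf A.obj₁) (h₂ : Perf A.obj₂) : Perf A.obj₃ := by
  obtain ⟨P, a, b, hP, ⟨e⟩⟩ := h₁
  obtain ⟨P', a', b', hP', ⟨e'⟩⟩ := h₂
  obtain ⟨φ, hφ⟩ := lift_chain hP.proj hP.gt (e.inv ≫ A.mor₁ ≫ e'.hom)
  let E := isoTriangleOfIso₁₂ A _ hA (mappingCone_triangle_distinguished φ) e e' (by
    change _ = e.hom ≫ Q.map φ
    rw [hφ, Iso.hom_inv_id_assoc]
    rfl)
  exact (hP.cone hP' φ).perf.of_iso (Triangle.π₃.mapIso E)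

lemma Perf.ext₂ (A : Triangle (DerivedCategory (ModuleCat.{0} Λ))) (hA : A ∈ distTriang _)
    (h₁ : Perf A.obj₁) (h₃ : Perf A.obj₃) : Perf A.obj₂ :=
  Perf.cone A.invRotate (inv_rot_of_distTriang _ hA) (h₃.shift (-1)) h₁

lemma Perf.biprod {X Y : DerivedCategory (ModuleCat.{0} Λ)} (hX : Perf X) (hY : Perf Y) :
    Perf (X ⊞ Y) :=
  Perf.ext₂ _ (binaryBiproductTriangle_distinguished X Y) hX hY

lemma Perf.zero {X : DerivedCategory (ModuleCat.{0} Λ)} (hX : IsZero X) : Perf X := by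
  have h : Perf (Q.obj (sg 0 (0 : ModuleCat.{0} Λ))) := by
    have := fin_of_zero (isZero_zero (ModuleCat.{0} Λ))
    have := proj_of_zero (isZero_zero (ModuleCat.{0} Λ))
    exact (Bfp.single 0 (0 : ModuleCat.{0} Λ)).perf
  refine h.of_iso (hX.iso ?_)
  apply Functor.map_isZero
  apply Functor.map_isZero
  exact isZero_zero _

/-- generators -/
abbrev S (Λ : Type) [Ring Λ] [HasDerivedCategory (ModuleCat.{0} Λ)] (k : ℤ) :
    DerivedCategory (ModuleCat.{0} Λ) := Q.obj (sg k (ModuleCat.of Λ Λ))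

lemma S_perf (k : ℤ) : Perf (S Λ k) := (Bfp.single k (ModuleCat.of Λ Λ)).perf

end PerfClosure
end
end CptAux



namespace CptAux
noncomputable section
section Gen
open Pretriangulated ZeroObject
variable {Λ : Type} [Ring Λ] [HasDerivedCategory (ModuleCat.{0} Λ)]

/-- all maps from `S k` vanish -/
def Orth (k : ℤ) (X : DerivedCategory (ModuleCat.{0} Λ)) : Prop := ∀ g : S Λ k ⟶ X, g = 0

lemma isZero_of_id {T : Type*} [Category T] [Preadditive T] {X : T} (h : 𝟙 X = 0) : IsZero X :=
  (IsZero.iff_id_eq_zero X).2 h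

lemma Q_isZero {Y : CochainComplex (ModuleCat.{0} Λ) ℤ} (h : ∀ n, IsZero (Y.homology n)) :
    IsZero (Q.obj Y) := by
  have h1 : QuasiIso (0 : Y ⟶ Y) := by
    rw [quasiIso_iff]
    intro n
    rw [quasiIsoAt_iff_isIso_homologyMap]
    exact ⟨0, (h n).eq_of_src _ _, (h n).eq_of_src _ _⟩
  have h2 : IsIso (Q.map (0 : Y ⟶ Y)) := inferInstance
  rw [Functor.map_zero] at h2
  apply isZero_of_id
  rw [← IsIso.hom_inv_id (0 : Q.obj Y ⟶ Q.obj Y), zero_comp]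

lemma homologyMap_zero_of_Q {X Y : CochainComplex (ModuleCat.{0} Λ) ℤ} (φ : X ⟶ Y)
    (h : Q.map φ = 0) (n : ℤ) : HomologicalComplex.homologyMap φ n = 0 := by
  have := (homologyFunctorFactors (ModuleCat.{0} Λ) n).hom.naturality φ
  have hz : (Q ⋙ homologyFunctor (ModuleCat.{0} Λ) n).map φ = 0 := by
    rw [Functor.comp_map, h, Functor.map_zero]
  rw [hz, zero_comp] at this
  have := this.symm
  rwa [Preadditive.IsIso.comp_left_eq_zero] at this

lemma homology_zero {Y : CochainComplex (ModuleCat.{0} Λ) ℤ} (n : ℤ)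
    (h : Orth n (Q.obj Y)) : IsZero (Y.homology n) := by
  have : Subsingleton (Y.homology n) := by
    refine subsingleton_of_forall_eq 0 fun z => ?_
    obtain ⟨y, rfl⟩ := (ModuleCat.epi_iff_surjective _).1
      (inferInstance : Epi (Y.homologyπ n)) z
    let α : ModuleCat.of Λ Λ ⟶ Y.cycles n := ModuleCat.ofHom (LinearMap.toSpanSingleton Λ (Y.cycles n) y)
    let φ : sg n (ModuleCat.of Λ Λ) ⟶ Y := HomologicalComplex.mkHomFromSingle
      (α ≫ Y.iCycles n) (fun k _ => by rw [Category.assoc, HomologicalComplex.iCycles_d, comp_zero])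
    have h0 := homologyMap_zero_of_Q φ (h _) n
    let ψ : ModuleCat.of Λ Λ ⟶ (sg n (ModuleCat.of Λ Λ)).cycles n :=
      (sg n (ModuleCat.of Λ Λ)).liftCycles
        (HomologicalComplex.singleObjXSelf (ComplexShape.up ℤ) n (ModuleCat.of Λ Λ)).inv
        (n + 1) (by simp) (by simp)
    have h1 : ψ ≫ HomologicalComplex.cyclesMap φ n = α := by
      rw [← cancel_mono (Y.iCycles n), Category.assoc, HomologicalComplex.cyclesMap_i,
        HomologicalComplex.liftCycles_i_assoc, HomologicalComplex.mkHomFromSingle_f,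
        Iso.inv_hom_id_assoc]
    have h2 : α ≫ Y.homologyπ n = 0 := by
      rw [← h1, Category.assoc, ← HomologicalComplex.homologyπ_naturality, h0, comp_zero, comp_zero]
    have h3 := congrArg (fun ψ => ψ.hom (1 : Λ)) h2
    have h4 : α.hom (1 : Λ) = y := one_smul Λ y
    simp only [ModuleCat.hom_comp, LinearMap.comp_apply] at h3
    rw [← h4]
    exact h3
  exact ModuleCat.isZero_of_subsingleton _

lemma Orth.of_iso {k : ℤ} {X Y : DerivedCategory (ModuleCat.{0} Λ)} (h : Orth k X) (e : X ≅ Y) :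
    Orth k Y := fun g => by
  have := h (g ≫ e.inv)
  rwa [Preadditive.IsIso.comp_right_eq_zero] at this

lemma Orth.of_retract {k : ℤ} {X Y : DerivedCategory (ModuleCat.{0} Λ)} (h : Orth k X)
    (i : Y ⟶ X) (r : X ⟶ Y) (hir : i ≫ r = 𝟙 Y) : Orth k Y := fun g => by
  rw [← Category.comp_id g, ← hir, ← Category.assoc, h (g ≫ i), zero_comp]

/-- the `S k` generate -/
lemma gen {X : DerivedCategory (ModuleCat.{0} Λ)} (h : ∀ k, Orth k X) : IsZero X := by
  refine IsZero.of_iso ?_ (Q.objObjPreimageIso X).symm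
  exact Q_isZero fun n => homology_zero n ((h n).of_iso (Q.objObjPreimageIso X).symm)

lemma orth_of_isZero {P : CochainComplex (ModuleCat.{0} Λ) ℤ} {k : ℤ}
    (h : IsZero (P.X k)) : Orth k (Q.obj P) := by
  intro g
  obtain ⟨φ, rfl⟩ := lift_chain (Bfp.single k (ModuleCat.of Λ Λ)).proj
    (Bfp.single k (ModuleCat.of Λ Λ)).gt g
  have : φ = 0 := HomologicalComplex.from_single_hom_ext (h.eq_of_tgt _ _)
  rw [this, Functor.map_zero]

lemma orth_single {X : DerivedCategory (ModuleCat.{0} Λ)} {k : ℤ} (h : Orth k X)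
    (M : ModuleCat.{0} Λ) [Module.Finite Λ M] [Module.Projective Λ M]
    (g : Q.obj (sg k M) ⟶ X) : g = 0 := by
  obtain ⟨n, f, r, -, -, hfr⟩ := Module.Finite.exists_comp_eq_id_of_projective Λ M
  let F := HomologicalComplex.single (ModuleCat.{0} Λ) (ComplexShape.up ℤ) k ⋙
    Q (C := ModuleCat.{0} Λ)
  let α : Fin n → (M ⟶ ModuleCat.of Λ Λ) := fun i =>
    ModuleCat.ofHom (LinearMap.proj i ∘ₗ r)
  let β : Fin n → (ModuleCat.of Λ Λ ⟶ M) := fun i =>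
    ModuleCat.ofHom (f ∘ₗ LinearMap.single Λ (fun _ => Λ) i)
  have hid : 𝟙 M = ∑ i, α i ≫ β i := by
    ext m
    simp only [ModuleCat.hom_id, LinearMap.id_apply, ModuleCat.hom_sum, LinearMap.sum_apply,
      ModuleCat.hom_comp, LinearMap.comp_apply, α, β, ModuleCat.hom_ofHom]
    rw [← map_sum]
    simp only [LinearMap.proj_apply, LinearMap.single_apply]
    rw [Finset.univ_sum_single]
    exact (LinearMap.congr_fun hfr m).symm
  have h1 : 𝟙 (F.obj M) = ∑ i, F.map (α i) ≫ F.map (β i) := by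
    rw [← F.map_id, hid, F.map_sum]
    simp only [F.map_comp]
  have h2 : ∀ i, F.map (β i) ≫ (show F.obj M ⟶ X from g) = 0 := fun i => h _
  change (show F.obj M ⟶ X from g) = 0
  rw [← Category.id_comp (show F.obj M ⟶ X from g), h1, Preadditive.sum_comp]
  refine Finset.sum_eq_zero fun i _ => ?_
  rw [Category.assoc, h2, comp_zero]

/-- isomorphism between shifts of single complexes -/
def sgShift (M : ModuleCat.{0} Λ) (n a a' : ℤ) (h : n + a = a') :
    (Q.obj (sg a' M))⟦n⟧ ≅ Q.obj (sg a M) :=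
  ((singleFunctors (ModuleCat.{0} Λ)).shiftIso n a a' h).app M

end Gen
end
end CptAux



namespace CptAux
noncomputable section
section TriMk
open Pretriangulated
variable {T : Type*} [Category T] [Preadditive T] [HasZeroObject T] [HasShift T ℤ]
  [∀ n : ℤ, (shiftFunctor T n).Additive] [Pretriangulated T]
  {X Y Z : T} {x : X ⟶ Y} {y : Y ⟶ Z} {δ : Z ⟶ X⟦(1:ℤ)⟧}

lemma tlift₂ (hA : Triangle.mk x y δ ∈ distTriang T) {K : T}
    (g : K ⟶ Y) (h : g ≫ y = 0) : ∃ u : K ⟶ X, g = u ≫ x :=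
  Triangle.coyoneda_exact₂ _ hA g h

lemma tlift₃ (hA : Triangle.mk x y δ ∈ distTriang T) {K : T}
    (g : K ⟶ Z) (h : g ≫ δ = 0) : ∃ u : K ⟶ Y, g = u ≫ y :=
  Triangle.coyoneda_exact₃ _ hA g h

lemma tdesc₂ (hA : Triangle.mk x y δ ∈ distTriang T) {K : T}
    (g : Y ⟶ K) (h : x ≫ g = 0) : ∃ u : Z ⟶ K, g = y ≫ u :=
  Triangle.yoneda_exact₂ _ hA g h

lemma tdesc₃ (hA : Triangle.mk x y δ ∈ distTriang T) {K : T}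
    (g : Z ⟶ K) (h : y ≫ g = 0) : ∃ u : X⟦(1:ℤ)⟧ ⟶ K, g = δ ≫ u :=
  Triangle.yoneda_exact₃ _ hA g h

end TriMk

section Tower
open Pretriangulated ZeroObject
variable {Λ : Type} [Ring Λ] [HasDerivedCategory (ModuleCat.{0} Λ)]

/-- factorization through a perfect object -/
def FactPerf {K Y : DerivedCategory (ModuleCat.{0} Λ)} (g : K ⟶ Y) : Prop :=
  ∃ (F : DerivedCategory (ModuleCat.{0} Λ)) (_ : Perf F) (u : K ⟶ F) (v : F ⟶ Y), g = u ≫ v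

lemma fin_split {ι : Type} [DecidableEq ι] {f : ι → DerivedCategory (ModuleCat.{0} Λ)}
    {c : Cofan f} (hc : IsColimit c) (hf : ∀ i, Perf (f i)) (J : Finset ι) :
    ∃ (X : DerivedCategory (ModuleCat.{0} Λ)) (_ : Perf X) (p : c.pt ⟶ X) (i : X ⟶ c.pt),
      p ≫ i = cE hc J := by
  induction J using Finset.induction_on with
  | empty => exact ⟨0, Perf.zero (isZero_zero _), 0, 0, by simp [cE]⟩
  | insert a J ha ih =>
    obtain ⟨X, hX, p, i, hpi⟩ := ih
    refine ⟨X ⊞ f a, hX.biprod (hf a), biprod.lift p (cproj hc a), biprod.desc i (c.inj a), ?_⟩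
    rw [biprod.lift_desc, hpi, cE, cE, Finset.sum_insert ha, add_comm]

lemma ext_fact {ι : Type} [DecidableEq ι] {f : ι → DerivedCategory (ModuleCat.{0} Λ)}
    {c : Cofan f} (hc : IsColimit c) (hf : ∀ i, Perf (f i))
    {Y Z : DerivedCategory (ModuleCat.{0} Λ)} (x : c.pt ⟶ Y) (y : Y ⟶ Z) (δ : Z ⟶ c.pt⟦(1:ℤ)⟧)
    (hA : Triangle.mk x y δ ∈ distTriang _) {K : DerivedCategory (ModuleCat.{0} Λ)} (hK : Cpt K)
    (g : K ⟶ Y) (hg : FactPerf (g ≫ y)) : FactPerf g := by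
  obtain ⟨F, hF, u, v, huv⟩ := hg
  obtain ⟨J, hJ⟩ := hF.cpt.shift_fac hc 1 (v ≫ δ)
  obtain ⟨X, hX, p, i, hpi⟩ := fin_split hc hf J
  have hyδ : y ≫ δ = 0 := comp_distTriang_mor_zero₂₃ _ hA
  let w' : F ⟶ X⟦(1:ℤ)⟧ := (v ≫ δ) ≫ p⟦(1:ℤ)⟧'
  have hw' : w' ≫ i⟦(1:ℤ)⟧' = v ≫ δ := by
    rw [Category.assoc, ← Functor.map_comp, hpi, hJ]
  have huw : u ≫ w' = 0 := by
    simp only [w']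
    rw [← Category.assoc, ← Category.assoc, ← huv, Category.assoc g, hyδ, comp_zero, zero_comp]
  obtain ⟨Y', α, β, hB⟩ := distinguished_cocone_triangle₂ w'
  obtain ⟨y', hy1, hy2⟩ := complete_distinguished_triangle_morphism₂ _ _ hB hA i v hw'
  change Y' ⟶ Y at y'
  have hy2 : β ≫ v = y' ≫ y := hy2
  obtain ⟨u', hu'⟩ := tlift₃ hB u huw
  obtain ⟨h, hh⟩ := tlift₂ hA (g - u' ≫ y') (by
    rw [Preadditive.sub_comp, huv, hu', Category.assoc, Category.assoc, hy2, sub_self])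
  obtain ⟨J', hJ'⟩ := hK f c hc h
  obtain ⟨X', hX', p', i', hpi'⟩ := fin_split hc hf J'
  have hY' : Perf Y' := Perf.ext₂ _ hB hX hF
  refine ⟨Y' ⊞ X', hY'.biprod hX', biprod.lift u' (h ≫ p'), biprod.desc y' (i' ≫ x), ?_⟩
  rw [biprod.lift_desc, Category.assoc, ← Category.assoc p', hpi', ← Category.assoc, hJ', ← hh]
  abel

lemma step (C : DerivedCategory (ModuleCat.{0} Λ)) :
    ∃ (C' : DerivedCategory (ModuleCat.{0} Λ)) (φ : C ⟶ C'),
      (∀ (k : ℤ) (g : S Λ k ⟶ C), g ≫ φ = 0) ∧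
      (∀ {K : DerivedCategory (ModuleCat.{0} Λ)} (_ : Cpt K) (g : K ⟶ C),
        FactPerf (g ≫ φ) → FactPerf g) := by
  classical
  let Y := Q.objPreimage C
  let e : Q.obj Y ≅ C := Q.objObjPreimageIso C
  let ι : Type := Σ k : ℤ, (sg k (ModuleCat.of Λ Λ) ⟶ Y)
  let f : ι → DerivedCategory (ModuleCat.{0} Λ) := fun i => S Λ i.1
  obtain ⟨c, ⟨hc⟩⟩ := exists_coprod f
  let x : c.pt ⟶ C := Cofan.IsColimit.desc hc (fun i => Q.map i.2 ≫ e.hom)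
  obtain ⟨C', φ, δ, hA⟩ := distinguished_cocone_triangle x
  refine ⟨C', φ, ?_, ?_⟩
  · intro k g
    obtain ⟨ψ, hψ⟩ := lift_chain (Bfp.single k (ModuleCat.of Λ Λ)).proj
      (Bfp.single k (ModuleCat.of Λ Λ)).gt (g ≫ e.inv)
    have h1 : g = c.inj (⟨k, ψ⟩ : ι) ≫ x := by
      have : c.inj (⟨k, ψ⟩ : ι) ≫ x = Q.map ψ ≫ e.hom := Cofan.IsColimit.fac hc _ _
      rw [this, hψ, Category.assoc, Iso.inv_hom_id, Category.comp_id]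
    have h2 : x ≫ φ = 0 := comp_distTriang_mor_zero₁₂ _ hA
    rw [h1, Category.assoc, h2, comp_zero]
  · intro K hK g hg
    exact ext_fact hc (fun i => S_perf i.1) x φ δ hA hK g hg

lemma kill_shift {X Y : DerivedCategory (ModuleCat.{0} Λ)} (φ : X ⟶ Y)
    (h : ∀ (k : ℤ) (g : S Λ k ⟶ X), g ≫ φ = 0) (k : ℤ) (g : S Λ k ⟶ X⟦(1:ℤ)⟧) :
    g ≫ φ⟦(1:ℤ)⟧' = 0 := by
  let e : (S Λ (1 + k))⟦(1:ℤ)⟧ ≅ S Λ k := sgShift (ModuleCat.of Λ Λ) 1 k (1 + k) rfl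
  obtain ⟨g', hg'⟩ := (shiftFunctor _ (1:ℤ)).map_surjective (e.hom ≫ g)
  have : e.hom ≫ g ≫ φ⟦(1:ℤ)⟧' = 0 := by
    rw [← Category.assoc, ← hg', ← Functor.map_comp, h, Functor.map_zero]
  rwa [Preadditive.IsIso.comp_left_eq_zero] at this

lemma tower (Cn : ℕ → DerivedCategory (ModuleCat.{0} Λ)) (φ : ∀ n, Cn n ⟶ Cn (n + 1))
    (h : ∀ n (k : ℤ) (g : S Λ k ⟶ Cn n), g ≫ φ n = 0)
    (h' : ∀ n {K : DerivedCategory (ModuleCat.{0} Λ)} (_ : Cpt K) (g : K ⟶ Cn n),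
        FactPerf (g ≫ φ n) → FactPerf g) (h0 : Cpt (Cn 0)) : FactPerf (𝟙 (Cn 0)) := by
  obtain ⟨c, ⟨hc⟩⟩ := exists_coprod Cn
  let s : c.pt ⟶ c.pt := Cofan.IsColimit.desc hc (fun n => φ n ≫ c.inj (n + 1))
  have hs : ∀ n, c.inj n ≫ s = φ n ≫ c.inj (n + 1) := fun n => Cofan.IsColimit.fac hc _ _
  have hsπ : ∀ n, s ≫ cproj hc (n + 1) = cproj hc n ≫ φ n := by
    intro n
    refine Cofan.IsColimit.hom_ext hc _ _ fun m => ?_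
    rw [← Category.assoc, ← Category.assoc, hs, Category.assoc]
    by_cases hm : m = n
    · subst hm; rw [inj_cproj, inj_cproj]; simp
    · rw [inj_cproj_ne _ hm, inj_cproj_ne hc (show m + 1 ≠ n + 1 by omega)]; simp
  have hsπ0 : s ≫ cproj hc 0 = 0 := by
    refine Cofan.IsColimit.hom_ext hc _ _ fun m => ?_
    rw [← Category.assoc, hs, Category.assoc, inj_cproj_ne hc (show m + 1 ≠ 0 by omega)]; simp
  have k1 : ∀ k (m : S Λ k ⟶ c.pt), m ≫ s = 0 := by
    intro k m
    obtain ⟨J, hJ⟩ := (S_perf k).cpt Cn c hc m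
    rw [← hJ, cE, Preadditive.comp_sum, Preadditive.sum_comp]
    refine Finset.sum_eq_zero fun i _ => ?_
    rw [Category.assoc, Category.assoc, hs, ← Category.assoc, ← Category.assoc, h, zero_comp]
  have k2 : ∀ k (m : S Λ k ⟶ c.pt⟦(1:ℤ)⟧), m ≫ s⟦(1:ℤ)⟧' = 0 := kill_shift s k1
  obtain ⟨Z, β, δ, hA⟩ := distinguished_cocone_triangle (𝟙 c.pt - s)
  have hZ : IsZero Z := by
    apply gen
    intro k g
    have h1 : δ ≫ (𝟙 c.pt - s)⟦(1:ℤ)⟧' = 0 := comp_distTriang_mor_zero₃₁ _ hA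
    have h2 : g ≫ δ = 0 := by
      have h3 : (g ≫ δ) ≫ (𝟙 c.pt - s)⟦(1:ℤ)⟧' = 0 := by
        rw [Category.assoc, h1, comp_zero]
      rw [Functor.map_sub, Preadditive.comp_sub, k2, sub_zero, CategoryTheory.Functor.map_id,
        Category.comp_id] at h3
      exact h3
    obtain ⟨g', hg'⟩ := tlift₃ hA g h2
    have h4 : (𝟙 c.pt - s) ≫ β = 0 := comp_distTriang_mor_zero₁₂ _ hA
    have h5 : g' ≫ (𝟙 c.pt - s) = g' := by
      rw [Preadditive.comp_sub, k1, sub_zero, Category.comp_id]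
    rw [hg', ← h5, Category.assoc, h4, comp_zero]
  obtain ⟨a, ha⟩ := tlift₂ hA (c.inj 0) (hZ.eq_of_tgt _ _)
  rw [Preadditive.comp_sub, Category.comp_id] at ha
  have a0 : a ≫ cproj hc 0 = 𝟙 _ := by
    have := congrArg (fun t => t ≫ cproj hc 0) ha
    simp only [inj_cproj, Preadditive.sub_comp, Category.assoc, hsπ0, comp_zero, sub_zero] at this
    exact this.symm
  have a1 : ∀ n, a ≫ cproj hc (n + 1) = (a ≫ cproj hc n) ≫ φ n := by
    intro n
    have := congrArg (fun t => t ≫ cproj hc (n+1)) ha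
    simp only [inj_cproj_ne hc (show 0 ≠ n + 1 by omega), Preadditive.sub_comp, Category.assoc,
      hsπ] at this
    rw [Category.assoc]
    exact (sub_eq_zero.1 this.symm)
  obtain ⟨J, hJ⟩ := h0 Cn c hc a
  obtain ⟨N, hN⟩ := Infinite.exists_notMem_finset J
  have key : ∀ m n, n + m = N → FactPerf (a ≫ cproj hc n) := by
    intro m
    induction m with
    | zero =>
      intro n hn
      have hn : n = N := by omega
      subst hn
      rw [← hJ, Category.assoc, cE_proj_not hc hN, comp_zero]
      exact ⟨0, Perf.zero (isZero_zero _), 0, 0, by simp⟩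
    | succ m ih =>
      intro n hn
      apply h' n h0
      rw [← a1]
      exact ih (n + 1) (by omega)
  rw [← a0]
  exact key N 0 (by omega)

lemma Cpt.retract {C : DerivedCategory (ModuleCat.{0} Λ)} (hC : Cpt C) :
    ∃ (P : CochainComplex (ModuleCat.{0} Λ) ℤ) (a b : ℤ) (_ : Bfp P a b) (i : C ⟶ Q.obj P)
      (r : Q.obj P ⟶ C), i ≫ r = 𝟙 C := by
  choose T φ h1 h2 using step (Λ := Λ)
  let Cn : ℕ → DerivedCategory (ModuleCat.{0} Λ) := fun n => Nat.rec C (fun _ X => T X) n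
  obtain ⟨F, ⟨P, a, b, hP, ⟨e⟩⟩, u, v, huv⟩ := tower Cn (fun n => φ (Cn n)) (fun n => h1 (Cn n))
    (fun n => h2 (Cn n)) hC
  change C ⟶ F at u
  change F ⟶ C at v
  refine ⟨P, a, b, hP, u ≫ e.hom, e.inv ≫ v, ?_⟩
  rw [Category.assoc, Iso.hom_inv_id_assoc]
  exact huv.symm

end Tower
end
end CptAux



namespace CptAux
noncomputable section
section EndGame
open Pretriangulated ZeroObject
variable {Λ : Type} [Ring Λ]

lemma Bfp.mono {P : CochainComplex (ModuleCat.{0} Λ) ℤ} {a b a' b' : ℤ} (h : Bfp P a b)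
    (ha : a' ≤ a) (hb : b ≤ b') : Bfp P a' b' where
  fin := h.fin
  proj := h.proj
  lt n hn := h.lt n (by omega)
  gt n hn := h.gt n (by omega)

/-- inclusion of the top term -/
def topInc (P : CochainComplex (ModuleCat.{0} Λ) ℤ) (b : ℤ) (h : ∀ n, b < n → IsZero (P.X n)) :
    sg b (P.X b) ⟶ P :=
  HomologicalComplex.mkHomFromSingle (𝟙 (P.X b)) (fun k hk => by
    simp at hk
    exact (h k (by omega)).eq_of_tgt _ _)

lemma topInc_f (P : CochainComplex (ModuleCat.{0} Λ) ℤ) (b : ℤ)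
    (h : ∀ n, b < n → IsZero (P.X n)) :
    (topInc P b h).f b = (HomologicalComplex.singleObjXSelf (ComplexShape.up ℤ) b (P.X b)).hom := by
  rw [topInc, HomologicalComplex.mkHomFromSingle_f, Category.comp_id]

lemma topInc_fac (P : CochainComplex (ModuleCat.{0} Λ) ℤ) (b : ℤ)
    (h : ∀ n, b < n → IsZero (P.X n)) {N : ModuleCat.{0} Λ} (ψ : sg b N ⟶ P) :
    ∃ m : N ⟶ P.X b,
      ψ = (HomologicalComplex.single (ModuleCat.{0} Λ) (ComplexShape.up ℤ) b).map m ≫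
        topInc P b h := by
  refine ⟨(HomologicalComplex.singleObjXSelf (ComplexShape.up ℤ) b N).inv ≫ ψ.f b, ?_⟩
  apply HomologicalComplex.from_single_hom_ext
  rw [HomologicalComplex.comp_f, topInc_f, HomologicalComplex.single_map_f_self]
  simp

variable [HasDerivedCategory (ModuleCat.{0} Λ)]

lemma chop {P : CochainComplex (ModuleCat.{0} Λ) ℤ} {a b : ℤ} (hP : Bfp P a b) :
    ∃ (P' : CochainComplex (ModuleCat.{0} Λ) ℤ) (_ : Bfp P' a (b - 1))
      (y : Q.obj P ⟶ Q.obj P') (δ : Q.obj P' ⟶ (Q.obj (sg b (P.X b)))⟦(1:ℤ)⟧),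
      Triangle.mk (Q.map (topInc P b hP.gt)) y δ ∈ distTriang _ := by
  let α := topInc P b hP.gt
  have hiso : IsIso (α.f b) := by
    simp only [α]; rw [topInc_f]; infer_instance
  have hm : Mono α := by
    apply +allowSynthFailures HomologicalComplex.mono_of_mono_f
    intro n
    by_cases h : n = b
    · subst h; infer_instance
    · exact (HomologicalComplex.isZero_single_obj_X _ _ _ _ h).mono _
  let e : ∀ n, (cokernel α).X n ≅ cokernel (α.f n) := fun n =>
    PreservesCokernel.iso (HomologicalComplex.eval (ModuleCat.{0} Λ) (ComplexShape.up ℤ) n) α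
  have hb : IsZero ((cokernel α).X b) := by
    refine IsZero.of_iso ?_ (e b)
    exact isZero_cokernel_of_epi _
  have hn : ∀ n, n ≠ b → Nonempty (P.X n ≅ (cokernel α).X n) := by
    intro n hn
    have h0 : α.f n = 0 := (HomologicalComplex.isZero_single_obj_X _ _ _ _ hn).eq_of_src _ _
    refine ⟨(e n ≪≫ cokernelIsoOfEq h0 ≪≫ cokernelZeroIsoTarget).symm⟩
  have hB : Bfp (cokernel α) a (b - 1) :=
    { fin := fun n => by
        by_cases h : n = b
        · subst h; exact fin_of_zero hb
        · exact fin_of_iso (hn n h).some (hP.fin n)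
      proj := fun n => by
        by_cases h : n = b
        · subst h; exact proj_of_zero hb
        · exact proj_of_iso (hn n h).some (hP.proj n)
      lt := fun n h' => by
        by_cases h : n = b
        · subst h; exact hb
        · exact (hP.lt n h').of_iso (hn n h).some.symm
      gt := fun n h' => by
        by_cases h : n = b
        · subst h; exact hb
        · exact (hP.gt n (by omega)).of_iso (hn n h).some.symm }
  let SC : ShortComplex (CochainComplex (ModuleCat.{0} Λ) ℤ) :=
    ShortComplex.mk α (cokernel.π α) (cokernel.condition α)
  have hS : SC.ShortExact :=
    { exact := ShortComplex.exact_cokernel α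
      mono_f := hm
      epi_g := (inferInstance : Epi (cokernel.π α)) }
  exact ⟨cokernel α, hB, _, _, triangleOfSES_distinguished hS⟩

lemma co_Bfp (n : ℕ) : ∀ {P : CochainComplex (ModuleCat.{0} Λ) ℤ} {a b : ℤ} (_ : Bfp P a b)
    (_ : b - a + 1 ≤ n) {X : DerivedCategory (ModuleCat.{0} Λ)} (_ : ∀ k, a ≤ k → Orth k X)
    (g : Q.obj P ⟶ X), g = 0 := by
  induction n with
  | zero =>
    intro P a b hP hab X hX g
    have : IsZero P := by
      apply isZero_of_id
      ext1 n
      by_cases h : n < a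
      · exact (hP.lt n h).eq_of_src _ _
      · exact (hP.gt n (by push_cast at hab; omega)).eq_of_src _ _
    exact (Functor.map_isZero Q this).eq_of_src _ _
  | succ n ih =>
    intro P a b hP hab X hX g
    by_cases hle : b < a
    · exact ih hP (by omega) hX g
    obtain ⟨P', hP', y, δ, hA⟩ := chop hP
    have := hP.fin b
    have := hP.proj b
    obtain ⟨u, rfl⟩ := tdesc₂ hA g (orth_single (hX b (by omega)) _ _)
    rw [ih hP' (by push_cast at hab; omega) hX u, comp_zero]

lemma chop_down {C : DerivedCategory (ModuleCat.{0} Λ)} {b : ℤ} (hC : ∀ k, b < k → Orth k C)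
    (n : ℕ) : ∀ {P : CochainComplex (ModuleCat.{0} Λ) ℤ} {a B : ℤ} (_ : Bfp P a B)
    (_ : B - b ≤ n) (i : C ⟶ Q.obj P) (r : Q.obj P ⟶ C) (_ : i ≫ r = 𝟙 C),
    ∃ (P' : CochainComplex (ModuleCat.{0} Λ) ℤ) (_ : Bfp P' a b) (i : C ⟶ Q.obj P')
      (r : Q.obj P' ⟶ C), i ≫ r = 𝟙 C := by
  induction n with
  | zero =>
    intro P a B hP hB i r hir
    exact ⟨P, hP.mono le_rfl (by push_cast at hB; omega), i, r, hir⟩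
  | succ n ih =>
    intro P a B hP hB i r hir
    by_cases hle : B ≤ b
    · exact ⟨P, hP.mono le_rfl hle, i, r, hir⟩
    obtain ⟨P', hP', y, δ, hA⟩ := chop hP
    have := hP.fin B
    have := hP.proj B
    obtain ⟨r', rfl⟩ := tdesc₂ hA r (orth_single (hC B (by omega)) _ _)
    exact ih hP' (by push_cast at hB; omega) (i ≫ y) r' (by rw [Category.assoc, hir])

lemma split_single {C : DerivedCategory (ModuleCat.{0} Λ)} (k : ℤ) (M : ModuleCat.{0} Λ)
    [Module.Finite Λ M] [Module.Projective Λ M] (i : C ⟶ Q.obj (sg k M)) (r : Q.obj (sg k M) ⟶ C)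
    (hir : i ≫ r = 𝟙 C) : Perf C := by
  let F := singleFunctor (ModuleCat.{0} Λ) k
  change C ⟶ F.obj M at i
  change F.obj M ⟶ C at r
  change i ≫ r = 𝟙 C at hir
  obtain ⟨p, hp⟩ := F.map_surjective (r ≫ i)
  have hpp : p ≫ p = p := by
    apply F.map_injective
    rw [F.map_comp, hp, Category.assoc, ← Category.assoc i, hir, Category.id_comp]
  let M' : ModuleCat.{0} Λ := ModuleCat.of Λ (LinearMap.range p.hom)
  let e : M' ⟶ M := ModuleCat.ofHom (LinearMap.range p.hom).subtype
  let s : M ⟶ M' := ModuleCat.ofHom p.hom.rangeRestrict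
  have hse : s ≫ e = p := by ext x; rfl
  have hes : e ≫ s = 𝟙 M' := by
    ext ⟨_, x, rfl⟩
    exact congrArg (fun t => t.hom x) hpp
  have hfin : Module.Finite Λ M' :=
    Module.Finite.of_surjective p.hom.rangeRestrict p.hom.surjective_rangeRestrict
  have hproj : Module.Projective Λ M' :=
    Module.Projective.of_split (LinearMap.range p.hom).subtype p.hom.rangeRestrict
      (congrArg ModuleCat.Hom.hom hes)
  have hperf : Perf (F.obj M') := (Bfp.single k M').perf
  refine hperf.of_iso ⟨i ≫ F.map s, F.map e ≫ r, ?_, ?_⟩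
  · rw [Category.assoc, ← Category.assoc (F.map s), ← F.map_comp, hse, hp, Category.assoc,
      ← Category.assoc, hir, Category.id_comp]
  · rw [Category.assoc, ← Category.assoc r, ← hp, ← F.map_comp, ← F.map_comp, ← hse,
      Category.assoc, hes, Category.comp_id, hes, F.map_id]

lemma main_ind (n : ℕ) : ∀ {C : DerivedCategory (ModuleCat.{0} Λ)} {a b : ℤ} (_ : b - a + 1 ≤ n)
    (_ : Cpt C) (_ : ∀ k, b < k → Orth k C)
    (_ : ∀ X : DerivedCategory (ModuleCat.{0} Λ), (∀ k, a ≤ k → Orth k X) → ∀ g : C ⟶ X, g = 0),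
    Perf C := by
  induction n with
  | zero =>
    intro C a b hab hC hO hco
    exact Perf.zero (isZero_of_id (hco C (fun k hk => hO k (by push_cast at hab; omega)) _))
  | succ n ih =>
    intro C a b hab hC hO hco
    by_cases hlt : b < a
    · exact ih (by omega) hC hO hco
    obtain ⟨P₀, a₀, b₀, hP₀, i₀, r₀, h₀⟩ := hC.retract
    obtain ⟨P, hP, i, r, hir⟩ := chop_down hO (b₀ - b).toNat hP₀ (by omega) i₀ r₀ h₀
    have := hP.fin b
    have := hP.proj b
    have hM : Perf (Q.obj (sg b (P.X b))) := (Bfp.single b (P.X b)).perf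
    let q : Q.obj (sg b (P.X b)) ⟶ C := Q.map (topInc P b hP.gt) ≫ r
    obtain ⟨C', y, δ, hA⟩ := distinguished_cocone_triangle q
    have hqy : q ≫ y = 0 := comp_distTriang_mor_zero₁₂ _ hA
    let E : (Q.obj (sg b (P.X b)))⟦(1:ℤ)⟧ ≅ Q.obj (sg (b - 1) (P.X b)) :=
      sgShift (P.X b) 1 (b - 1) b (by omega)
    have hC' : Cpt C' := Cpt.cone _ hA hM.cpt hC
    have hO' : ∀ k, b - 1 < k → Orth k C' := by
      intro k hk g
      have h1 : g ≫ δ = 0 := by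
        have h2 : Orth k (Q.obj (sg (b - 1) (P.X b))) := orth_of_isZero
          (HomologicalComplex.isZero_single_obj_X _ _ _ _ (by omega))
        exact (h2.of_iso E.symm) _
      obtain ⟨g', rfl⟩ := tlift₃ hA g h1
      by_cases hkb : k = b
      · subst hkb
        obtain ⟨ψ, hψ⟩ := lift_chain (Bfp.single k (ModuleCat.of Λ Λ)).proj
          (Bfp.single k (ModuleCat.of Λ Λ)).gt (g' ≫ i)
        obtain ⟨m, rfl⟩ := topInc_fac P k hP.gt ψ
        have h3 : g' = Q.map ((HomologicalComplex.single (ModuleCat.{0} Λ)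
            (ComplexShape.up ℤ) k).map m) ≫ q := by
          rw [← Category.comp_id g', ← hir, ← Category.assoc, ← hψ, Functor.map_comp,
            Category.assoc]
        rw [h3, Category.assoc, hqy, comp_zero]
      · rw [hO k (by omega) g', zero_comp]
    by_cases hba : b = a
    · subst hba
      have hy : y = 0 := hco C' (fun k hk => hO' k (by omega)) y
      obtain ⟨j, hj⟩ := tlift₂ hA (𝟙 C) (by rw [hy, comp_zero])
      exact split_single b (P.X b) j q hj.symm
    · have hperf : Perf C' := by
        refine ih (a := a) (b := b - 1) (by push_cast at hab; omega) hC' hO' ?_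
        intro X hX g
        obtain ⟨u, rfl⟩ := tdesc₃ hA g (hco X hX _)
        have hu : E.inv ≫ u = 0 := orth_single (hX (b - 1) (by omega)) _ _
        rw [Preadditive.IsIso.comp_left_eq_zero] at hu
        rw [hu, comp_zero]
      exact Perf.ext₂ _ hA hM hperf

lemma Cpt.perf {C : DerivedCategory (ModuleCat.{0} Λ)} (hC : Cpt C) : Perf C := by
  obtain ⟨P, a, b, hP, i, r, hir⟩ := hC.retract
  refine main_ind (b - a + 1).toNat (a := a) (b := b) (by omega) hC ?_ ?_
  · intro k hk
    exact (orth_of_isZero (hP.gt k hk)).of_retract i r hir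
  · intro X hX g
    rw [← Category.id_comp g, ← hir, Category.assoc,
      co_Bfp (b - a + 1).toNat hP (by omega) hX (r ≫ g), comp_zero]

end EndGame
end
end CptAux


/-- Let `Λ` be a ring.  In the derived category `D(Mod Λ)` the
compact objects are precisely the objects isomorphic to bounded complexes of
finitely generated projective `Λ`-modules. -/
theorem stmt_13 (Λ : Type) [Ring Λ] [HasDerivedCategory (ModuleCat.{0} Λ)]
    (C : DerivedCategory (ModuleCat.{0} Λ)) :
    IsCompactObject C ↔
      ∃ P : CochainComplex (ModuleCat.{0} Λ) ℤ,
        (∀ n : ℤ, Module.Finite Λ (P.X n)) ∧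
        (∀ n : ℤ, Module.Projective Λ (P.X n)) ∧
        (∃ a b : ℤ, ∀ n : ℤ, (n < a ∨ b < n) → IsZero (P.X n)) ∧
        Nonempty (C ≅ Q.obj P) := by
  rw [CptAux.isCompactObject_iff]
  constructor
  · intro h
    obtain ⟨P, a, b, hP, e⟩ := CptAux.Cpt.perf h
    exact ⟨P, hP.fin, hP.proj, ⟨a, b, fun n hn => hn.elim (hP.lt n) (hP.gt n)⟩, e⟩
  · rintro ⟨P, h1, h2, ⟨a, b, h3⟩, e⟩
    exact CptAux.Perf.cpt ⟨P, a, b,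
      ⟨h1, h2, fun n hn => h3 n (Or.inl hn), fun n hn => h3 n (Or.inr hn)⟩, e⟩
end
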